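/- arXiv:1710.06082 — 2 statements merged into one kernel-verified Lean document; each statement's English description precedes it below -/
import Mathlib

section
/- Let M : ℕ × ℕ → ℝ induce a bounded operator on ℓ² which is elliptic with constant C_ell > 0, fix a block structure on ℕ, and assume M is block-banded with bandwidth b₀ and M ∈ B(d,b₀) for a metric d on ℕ. Then there exists K > 0, independent of ε, such that for every ε > 0 there exist matrices L, D, U and a bandwidth b ∈ ℕ (depending only on M, b₀ and ε) with the following properties: ‖M − LDU‖₂ ≤ ε; L is block-lower triangular and U is block-upper triangular with unit diagonal blocks L(i,i) = U(i,i) = I; D is block-diagonal and elliptic; L, D, U induce bounded operators on ℓ² which are invertible with bounded inverses, with ‖L‖₂, ‖U‖₂, ‖D‖₂, ‖L⁻¹‖₂, ‖U⁻¹‖₂, ‖D⁻¹‖₂ all at most K; L⁻¹, D, U⁻¹ ∈ B(d,b); and L⁻¹ and U⁻¹ are block-banded with bandwidth b, i.e. L⁻¹(i,j) = U⁻¹(i,j) = 0 for all |i−j| > b. -/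
abbrev Mat := ℕ → ℕ → ℝ

noncomputable def mulVec (M : Mat) (x : ℕ → ℝ) : ℕ → ℝ := fun i => ∑' j, M i j * x j

def Memℓ2 (x : ℕ → ℝ) : Prop := Summable fun i => x i ^ 2

noncomputable def l2norm (x : ℕ → ℝ) : ℝ := Real.sqrt (∑' i, x i ^ 2)

def BoundedWith (M : Mat) (K : ℝ) : Prop :=
  ∀ x : ℕ → ℝ, Memℓ2 x →
    (∀ i, Summable fun j => |M i j * x j|) ∧ Memℓ2 (mulVec M x) ∧
      l2norm (mulVec M x) ≤ K * l2norm x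

def IsBoundedOp (M : Mat) : Prop := ∃ K : ℝ, 0 ≤ K ∧ BoundedWith M K

def Elliptic (M : Mat) (c : ℝ) : Prop :=
  ∀ x : ℕ → ℝ, Memℓ2 x → c * (∑' i, x i ^ 2) ≤ ∑' i, mulVec M x i * x i

def IsMetric (d : ℕ → ℕ → ℝ) : Prop :=
  (∀ i j, 0 ≤ d i j) ∧ (∀ i j, d i j = 0 ↔ i = j) ∧ (∀ i j, d i j = d j i) ∧
    ∀ i j k, d i k ≤ d i j + d j k

def Banded (d : ℕ → ℕ → ℝ) (b : ℝ) (M : Mat) : Prop := ∀ i j, b < d i j → M i j = 0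

def IsBlockStructure (n : ℕ → ℕ) : Prop := StrictMono n ∧ n 0 = 0

def InBlock (n : ℕ → ℕ) (i p : ℕ) : Prop := n i ≤ p ∧ p < n (i + 1)

def BlockBanded (n : ℕ → ℕ) (b : ℕ) (M : Mat) : Prop :=
  ∀ i j p q, InBlock n i p → InBlock n j q → (b : ℤ) < |(i : ℤ) - (j : ℤ)| → M p q = 0

def BlockDiag (n : ℕ → ℕ) (M : Mat) : Prop :=
  ∀ i j p q, InBlock n i p → InBlock n j q → i ≠ j → M p q = 0

def BlockLower (n : ℕ → ℕ) (M : Mat) : Prop :=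
  ∀ i j p q, InBlock n i p → InBlock n j q → i < j → M p q = 0

def BlockUpper (n : ℕ → ℕ) (M : Mat) : Prop :=
  ∀ i j p q, InBlock n i p → InBlock n j q → j < i → M p q = 0

def idMat : Mat := fun p q => if p = q then 1 else 0

def UnitDiagBlocks (n : ℕ → ℕ) (M : Mat) : Prop :=
  ∀ i p q, InBlock n i p → InBlock n i q → M p q = idMat p q

def matSub (A B : Mat) : Mat := fun p q => A p q - B p q

noncomputable def matMul (A B : Mat) : Mat := fun p q => ∑' r, A p r * B r q

def IsInverseOn (M N : Mat) : Prop :=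
  ∀ x : ℕ → ℝ, Memℓ2 x →
    Memℓ2 (mulVec M x) ∧ Memℓ2 (mulVec N x) ∧
      mulVec N (mulVec M x) = x ∧ mulVec M (mulVec N x) = x


namespace LDU

open Filter Topology

abbrev H := lp (fun _ : ℕ => ℝ) 2
abbrev Op := H →L[ℝ] H

noncomputable def e (q : ℕ) : H := lp.single 2 q (1 : ℝ)

lemma e_apply (q p : ℕ) : (e q : H) p = if p = q then 1 else 0 := by
  simp [e, Pi.single_apply]

noncomputable def toMat (T : Op) : Mat := fun p q => (T (e q)) p

lemma hasSum_sq (x : H) : HasSum (fun p => (x p) ^ 2) (‖x‖ ^ 2) := by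
  have h := lp.hasSum_inner (𝕜 := ℝ) x x
  rw [real_inner_self_eq_norm_sq] at h
  have he : (fun p => (x p) ^ 2) = fun p => inner ℝ (x p) (x p) := by
    funext p
    exact (real_inner_self_eq_norm_sq (x p)).trans (by simp) |>.symm
  rw [he]; exact h

lemma hasSum_in (x y : H) : HasSum (fun p => x p * y p) (inner ℝ x y) := by
  have h := lp.hasSum_inner (𝕜 := ℝ) x y
  have he : (fun p => x p * y p) = fun p => inner ℝ (x p) (y p) := by
    funext p
    exact mul_comm _ _
  rw [he]; exact h

lemma l2norm_coe (x : H) : l2norm (x : ℕ → ℝ) = ‖x‖ := by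
  rw [l2norm, (hasSum_sq x).tsum_eq, Real.sqrt_sq (norm_nonneg _)]

lemma mem_coe (x : H) : Memℓ2 (x : ℕ → ℝ) := (hasSum_sq x).summable

noncomputable def ofMem (x : ℕ → ℝ) (hx : Memℓ2 x) : H :=
  ⟨x, memℓp_gen (by simpa [Memℓ2] using hx)⟩

lemma ofMem_coe (x : ℕ → ℝ) (hx : Memℓ2 x) : (ofMem x hx : ℕ → ℝ) = x := rfl

lemma hasSum_mulVec (T : Op) (x : H) (p : ℕ) :
    HasSum (fun q => toMat T p q * x q) ((T x) p) := by
  have h := lp.hasSum_single (p := 2) (by simp) x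
  have h2 := h.mapL ((lp.evalCLM ℝ (fun _ : ℕ => ℝ) 2 p).comp T)
  have he : (fun q => toMat T p q * x q) = fun q =>
      ((lp.evalCLM ℝ (fun _ : ℕ => ℝ) 2 p).comp T) (lp.single 2 q (x q)) := by
    funext q
    have hs : lp.single 2 q (x q) = (x q) • e q := by
      rw [e, ← lp.single_smul]; simp
    rw [hs, map_smul, smul_eq_mul, mul_comm]; rfl
  rw [he]; exact h2

lemma mulVec_toMat (T : Op) (x : H) : mulVec (toMat T) (x : ℕ → ℝ) = T x := by
  funext p; exact (hasSum_mulVec T x p).tsum_eq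

lemma bounded_toMat (T : Op) {K : ℝ} (h : ‖T‖ ≤ K) : BoundedWith (toMat T) K := by
  intro x hx
  have hm := mulVec_toMat T (ofMem x hx)
  rw [ofMem_coe] at hm
  refine ⟨fun i => (hasSum_mulVec T (ofMem x hx) i).summable.abs, ?_, ?_⟩
  · rw [hm]; exact mem_coe _
  · rw [hm, l2norm_coe]
    conv_rhs => rw [← ofMem_coe x hx, l2norm_coe]
    exact T.le_of_opNorm_le h _

lemma toMat_mul (S T : Op) : toMat (S * T) = matMul (toMat S) (toMat T) := by
  funext p q
  exact ((hasSum_mulVec S (T (e q)) p).tsum_eq).symm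

lemma toMat_sub (S T : Op) : toMat (S - T) = matSub (toMat S) (toMat T) := by
  funext p q; simp [toMat, matSub]

lemma op_congr (T : Op) (x y : H) (p : ℕ) (h : ∀ q, toMat T p q = 0 ∨ x q = y q) :
    (T x) p = (T y) p := by
  have h1 := hasSum_mulVec T x p
  have h2 := hasSum_mulVec T y p
  refine h1.unique ?_
  convert h2 using 2 with q
  rcases h q with h | h <;> simp [h]

lemma op_zero (T : Op) (x : H) (p : ℕ) (h : ∀ q, toMat T p q = 0 ∨ x q = 0) :
    (T x) p = 0 := by
  rw [op_congr T x 0 p h]; simp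

lemma op_ext {S T : Op} (h : ∀ p q, toMat S p q = toMat T p q) : S = T := by
  ext x p
  refine (hasSum_mulVec S x p).unique ?_
  simp_rw [h]; exact hasSum_mulVec T x p

lemma toMat_star (T : Op) (p q : ℕ) : toMat (star T) p q = toMat T q p := by
  have h1 : ∀ (x : H) (r : ℕ), x r = inner ℝ x (e r) := by
    intro x r; rw [e, lp.inner_single_right]; simp
  simp only [toMat]
  rw [h1, ContinuousLinearMap.star_eq_adjoint, ContinuousLinearMap.adjoint_inner_left, h1 (T _),
    real_inner_comm]

lemma toMat_one (p q : ℕ) : toMat 1 p q = idMat p q := by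
  simp [toMat, e_apply, idMat]

lemma inverseOn (S T : Op) (h1 : S * T = 1) (h2 : T * S = 1) :
    IsInverseOn (toMat S) (toMat T) := by
  intro x hx
  have a := mulVec_toMat S (ofMem x hx)
  have b := mulVec_toMat T (ofMem x hx)
  rw [ofMem_coe] at a b
  rw [a, b, mulVec_toMat, mulVec_toMat]
  refine ⟨mem_coe _, mem_coe _, ?_, ?_⟩
  · change ((T * S) _ : H) = x
    rw [h2]; rfl
  · change ((S * T) _ : H) = x
    rw [h1]; rfl

lemma elliptic_toMat (T : Op) (c : ℝ) (h : ∀ x : H, c * ‖x‖ ^ 2 ≤ inner ℝ (T x) x) :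
    Elliptic (toMat T) c := by
  intro x hx
  have a := mulVec_toMat T (ofMem x hx)
  rw [ofMem_coe] at a
  have := h (ofMem x hx)
  rwa [← (hasSum_sq _).tsum_eq, ← (hasSum_in _ _).tsum_eq, ← a, ofMem_coe] at this

lemma mkOp (f : H → ℕ → ℝ) (hadd : ∀ x y p, f (x + y) p = f x p + f y p)
    (hsmul : ∀ (c : ℝ) x p, f (c • x) p = c * f x p) (c : ℝ) (hc : 0 ≤ c)
    (hb : ∀ x, ∀ s : Finset ℕ, ∑ p ∈ s, (f x p) ^ 2 ≤ (c * ‖x‖) ^ 2) :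
    ∃ T : Op, (∀ x p, (T x) p = f x p) ∧ ‖T‖ ≤ c := by
  have hmem : ∀ x, Memℓp (E := fun _ : ℕ => ℝ) (f x) 2 := fun x =>
    memℓp_gen' (C := (c * ‖x‖) ^ 2) (fun s => by simpa using hb x s)
  let T0 : H →ₗ[ℝ] H :=
    { toFun := fun x => ⟨f x, hmem x⟩
      map_add' := fun x y => by ext p; exact hadd x y p
      map_smul' := fun a x => by ext p; exact hsmul a x p }
  refine ⟨T0.mkContinuous c ?_, fun x p => rfl, LinearMap.mkContinuous_norm_le _ hc _⟩
  intro x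
  refine lp.norm_le_of_forall_sum_le (by simp) (by positivity) ?_
  intro s
  have h0 : ∀ p, (T0 x) p = f x p := fun p => rfl
  simpa [h0] using hb x s

lemma sum_sq_le (x : H) (s : Finset ℕ) : ∑ p ∈ s, (x p) ^ 2 ≤ ‖x‖ ^ 2 :=
  sum_le_hasSum s (fun _ _ => sq_nonneg _) (hasSum_sq x)

lemma exists_op (M : Mat) (hM : IsBoundedOp M) : ∃ T : Op, toMat T = M := by
  obtain ⟨K, hK, hb⟩ := hM
  have hs : ∀ (x : H) p, Summable fun q => M p q * x q := fun x p =>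
    ((hb x (mem_coe x)).1 p).of_abs
  obtain ⟨T, hT, -⟩ := mkOp (fun x => mulVec M x) (fun x y p => by
      simp only [mulVec]
      rw [← (hs x p).tsum_add (hs y p)]
      simp [mul_add]) (fun c x p => by
      simp only [mulVec]
      rw [← tsum_mul_left]
      congr 1; funext q; simp; ring) K hK (by
      intro x s
      obtain ⟨-, h2, h3⟩ := hb x (mem_coe x)
      rw [l2norm_coe] at h3
      have h4 := sum_sq_le (ofMem _ h2) s
      rw [← l2norm_coe, ofMem_coe] at h4
      refine h4.trans ?_
      exact pow_le_pow_left₀ (Real.sqrt_nonneg _) h3 2)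
  refine ⟨T, ?_⟩
  funext p q
  rw [toMat, hT, mulVec, tsum_eq_single q]
  · simp [e_apply]
  · intro r hr; simp [e_apply, hr]

lemma exists_ind (S : Set ℕ) : ∃ T : Op, (∀ x p, (T x) p = S.indicator (x : ℕ → ℝ) p) ∧ ‖T‖ ≤ 1 := by
  classical
  refine mkOp (fun x => S.indicator (x : ℕ → ℝ)) ?_ ?_ 1 zero_le_one ?_
  · intro x y p; simp [Set.indicator]; split_ifs <;> simp
  · intro x y p; simp [Set.indicator]
  · intro x s
    rw [one_mul]
    refine le_trans (Finset.sum_le_sum ?_) (sum_sq_le x s)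
    intro p _
    by_cases h : p ∈ S <;> simp [h, sq_nonneg]

noncomputable def ind (S : Set ℕ) : Op := (exists_ind S).choose

lemma ind_apply (S : Set ℕ) (x : H) (p : ℕ) : (ind S x) p = S.indicator (x : ℕ → ℝ) p :=
  (exists_ind S).choose_spec.1 x p

lemma ind_norm (S : Set ℕ) : ‖ind S‖ ≤ 1 := (exists_ind S).choose_spec.2

lemma ind_of_mem {S : Set ℕ} (x : H) {p : ℕ} (h : p ∈ S) : (ind S x) p = x p := by
  rw [ind_apply, Set.indicator_of_mem h]

lemma ind_of_notMem {S : Set ℕ} (x : H) {p : ℕ} (h : p ∉ S) : (ind S x) p = 0 := by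
  rw [ind_apply, Set.indicator_of_notMem h]

lemma ind_mul_self (S : Set ℕ) : ind S * ind S = ind S := by
  ext x p
  change (ind S (ind S x)) p = _
  by_cases h : p ∈ S
  · rw [ind_of_mem _ h]
  · rw [ind_of_notMem _ h, ind_of_notMem _ h]

/-- window of block indices -/
def win (blk : ℕ → ℕ) (w i : ℕ) : Set ℕ := {p | i ≤ blk p + w ∧ blk p ≤ i}

lemma win_sum (blk : ℕ → ℕ) (w : ℕ) (x : H) (I : Finset ℕ) :
    ∑ i ∈ I, ‖ind (win blk w i) x‖ ^ 2 ≤ (w + 1) * ‖x‖ ^ 2 := by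
  classical
  have h1 : HasSum (fun p => ∑ i ∈ I, ((ind (win blk w i) x) p) ^ 2)
      (∑ i ∈ I, ‖ind (win blk w i) x‖ ^ 2) :=
    hasSum_sum fun i _ => hasSum_sq _
  refine hasSum_le ?_ h1 ((hasSum_sq x).mul_left ((w : ℝ) + 1))
  intro p
  have h2 : ∀ i ∈ I, ((ind (win blk w i) x) p) ^ 2 =
      if i ∈ Finset.Icc (blk p) (blk p + w) then (x p) ^ 2 else 0 := by
    intro i _
    by_cases hp : i ≤ blk p + w ∧ blk p ≤ i
    · rw [ind_of_mem _ (show p ∈ win blk w i from hp), if_pos (Finset.mem_Icc.2 hp.symm)]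
    · rw [ind_of_notMem _ (show p ∉ win blk w i from hp), if_neg]
      · simp
      · exact fun h => hp (Finset.mem_Icc.1 h).symm
  rw [Finset.sum_congr rfl h2, Finset.sum_ite_mem, Finset.sum_const, nsmul_eq_mul]
  refine mul_le_mul_of_nonneg_right ?_ (sq_nonneg _)
  have : (I ∩ Finset.Icc (blk p) (blk p + w)).card ≤ w + 1 := by
    refine (Finset.card_le_card Finset.inter_subset_right).trans ?_
    simp; omega
  exact_mod_cast this

lemma exists_rows (blk : ℕ → ℕ) (A : ℕ → Op) (a : ℝ) (ha : 0 ≤ a) (w : ℕ)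
    (hA : ∀ i, ‖A i‖ ≤ a)
    (hw : ∀ p q, toMat (A (blk p)) p q ≠ 0 → q ∈ win blk w (blk p)) :
    ∃ T : Op, (∀ x p, (T x) p = (A (blk p) x) p) ∧ ‖T‖ ≤ a * (w + 1) := by
  classical
  refine mkOp (fun x p => (A (blk p) x) p) ?_ ?_ _ (by positivity) ?_
  · intro x y p; simp
  · intro c x p; simp
  intro x s
  have h1 : ∀ p, (A (blk p) x) p = (A (blk p) (ind (win blk w (blk p)) x)) p := by
    intro p
    apply op_congr
    intro q
    by_cases h : toMat (A (blk p)) p q = 0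
    · exact Or.inl h
    · right; rw [ind_of_mem _ (hw p q h)]
  calc ∑ p ∈ s, ((A (blk p) x) p) ^ 2
      = ∑ i ∈ s.image blk, ∑ p ∈ s with blk p = i, ((A (blk p) x) p) ^ 2 :=
        (Finset.sum_fiberwise_of_maps_to (fun p hp => Finset.mem_image_of_mem _ hp) _).symm
    _ ≤ ∑ i ∈ s.image blk, a ^ 2 * ‖ind (win blk w i) x‖ ^ 2 := by
        refine Finset.sum_le_sum fun i _ => ?_
        calc _ = ∑ p ∈ s with blk p = i, ((A i (ind (win blk w i) x)) p) ^ 2 := by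
              refine Finset.sum_congr rfl fun p hp => ?_
              rw [h1 p, (Finset.mem_filter.1 hp).2]
          _ ≤ ‖A i (ind (win blk w i) x)‖ ^ 2 := sum_sq_le _ _
          _ ≤ (a * ‖ind (win blk w i) x‖) ^ 2 :=
              pow_le_pow_left₀ (norm_nonneg _) ((A i).le_of_opNorm_le (hA i) _) 2
          _ = _ := by ring
    _ = a ^ 2 * ∑ i ∈ s.image blk, ‖ind (win blk w i) x‖ ^ 2 := by rw [Finset.mul_sum]
    _ ≤ a ^ 2 * ((w + 1) * ‖x‖ ^ 2) := by gcongr; exact win_sum _ _ _ _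
    _ ≤ (a * (w + 1) * ‖x‖) ^ 2 := by
        have : (0:ℝ) ≤ a ^ 2 * ‖x‖ ^ 2 * (w * (w + 1)) := by positivity
        nlinarith

/-- bandedness for operators -/
def OBand (δ : ℕ → ℕ → ℝ) (b : ℝ) (T : Op) : Prop := ∀ p q, b < δ p q → toMat T p q = 0

structure Semi (δ : ℕ → ℕ → ℝ) : Prop where
  self : ∀ p, δ p p = 0
  tri : ∀ p q r, δ p r ≤ δ p q + δ q r

lemma OBand.mul {δ : ℕ → ℕ → ℝ} (hδ : Semi δ) {a b : ℝ} {S T : Op} (hS : OBand δ a S)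
    (hT : OBand δ b T) : OBand δ (a + b) (S * T) := by
  intro p q h
  change (S (T (e q))) p = 0
  apply op_zero
  intro r
  by_cases h1 : a < δ p r
  · exact Or.inl (hS p r h1)
  · right; apply hT r q
    have := hδ.tri p r q
    linarith

lemma OBand.mono {δ : ℕ → ℕ → ℝ} {a b : ℝ} {S : Op} (hS : OBand δ a S) (h : a ≤ b) :
    OBand δ b S := fun p q hh => hS p q (h.trans_lt hh)

lemma OBand.ind {δ : ℕ → ℕ → ℝ} (hδ : Semi δ) (S : Set ℕ) : OBand δ 0 (ind S) := by
  intro p q h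
  have : p ≠ q := by rintro rfl; rw [hδ.self] at h; exact lt_irrefl _ h
  rw [toMat, ind_apply]
  by_cases hp : p ∈ S <;> simp [hp, e_apply, this]

lemma OBand.one {δ : ℕ → ℕ → ℝ} (hδ : Semi δ) {b : ℝ} (hb : 0 ≤ b) : OBand δ b 1 := by
  intro p q h
  have : p ≠ q := by rintro rfl; rw [hδ.self] at h; linarith
  rw [toMat_one]; simp [idMat, this]

lemma OBand.sub {δ : ℕ → ℕ → ℝ} {b : ℝ} {S T : Op} (hS : OBand δ b S) (hT : OBand δ b T) :
    OBand δ b (S - T) := by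
  intro p q h
  have h1 := hS p q h
  have h2 := hT p q h
  simp only [toMat] at *
  simp [h1, h2]

lemma OBand.smul {δ : ℕ → ℕ → ℝ} {b : ℝ} {S : Op} (c : ℝ) (hS : OBand δ b S) :
    OBand δ b (c • S) := by
  intro p q h
  have h1 := hS p q h
  simp only [toMat] at *
  simp [h1]

lemma OBand.sum {δ : ℕ → ℕ → ℝ} {b : ℝ} {S : ℕ → Op} (s : Finset ℕ)
    (hS : ∀ k ∈ s, OBand δ b (S k)) : OBand δ b (∑ k ∈ s, S k) := by
  intro p q h
  simp only [toMat]
  simp only [_root_.sum_apply, lp.coeFn_sum, Finset.sum_apply]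
  exact Finset.sum_eq_zero fun k hk => hS k hk p q h

lemma OBand.pow {δ : ℕ → ℕ → ℝ} (hδ : Semi δ) {b : ℝ} {S : Op} (hS : OBand δ b S) (k : ℕ) :
    OBand δ (k * b) (S ^ k) := by
  induction k with
  | zero => simpa using OBand.one hδ le_rfl
  | succ k ih =>
    rw [pow_succ]
    have := ih.mul hδ hS
    convert this using 1
    push_cast; ring

lemma exists_omega (T : Op) {c : ℝ} (hc : 0 < c) (h : ∀ x : H, c * ‖x‖ ^ 2 ≤ inner ℝ (T x) x) :
    ∃ ω : ℝ, 0 < ω ∧ ‖1 - ω • T‖ < 1 := by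
  set m := ‖T‖ with hm
  have hm0 : 0 ≤ m := norm_nonneg _
  have hden : 0 < m ^ 2 + c ^ 2 := by positivity
  set ω := c / (m ^ 2 + c ^ 2) with hω
  have hω0 : 0 < ω := by positivity
  have hωd : ω * (m ^ 2 + c ^ 2) = c := by rw [hω]; field_simp
  refine ⟨ω, hω0, ?_⟩
  have h1 : ω * c ≤ 1 := by
    have : ω * c = c ^ 2 / (m ^ 2 + c ^ 2) := by rw [hω]; ring
    rw [this, div_le_one hden]; nlinarith
  have h2 : ω ^ 2 * m ^ 2 ≤ ω * c := by nlinarith [mul_pos hω0 hω0, sq_nonneg c, sq_nonneg (ω * c)]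
  refine lt_of_le_of_lt (ContinuousLinearMap.opNorm_le_bound _ (Real.sqrt_nonneg (1 - ω * c)) ?_)
    (?_ : Real.sqrt (1 - ω * c) < 1)
  · intro x
    refine abs_le_of_sq_le_sq' ?_ (by positivity) |>.2
    rw [mul_pow, Real.sq_sqrt (by linarith)]
    have : (1 - ω • T) x = x - ω • T x := by simp
    rw [this, norm_sub_sq_real, norm_smul, inner_smul_right, real_inner_comm]
    have h3 := h x
    have h4 : ‖T x‖ ≤ m * ‖x‖ := T.le_opNorm x
    have h5 : ‖T x‖ ^ 2 ≤ m ^ 2 * ‖x‖ ^ 2 := by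
      rw [← mul_pow]; exact pow_le_pow_left₀ (norm_nonneg _) h4 2
    rw [mul_pow, Real.norm_eq_abs, sq_abs]
    have h6 : ω ^ 2 * ‖T x‖ ^ 2 ≤ ω * c * ‖x‖ ^ 2 := by
      calc _ ≤ ω ^ 2 * (m ^ 2 * ‖x‖ ^ 2) := by gcongr
        _ = ω ^ 2 * m ^ 2 * ‖x‖ ^ 2 := by ring
        _ ≤ _ := by gcongr
    have h7 := mul_le_mul_of_nonneg_left h3 hω0.le
    nlinarith
  · rw [Real.sqrt_lt' one_pos]; nlinarith [mul_pos hω0 hc]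

lemma isUnit_of_coercive (T : Op) {c : ℝ} (hc : 0 < c)
    (h : ∀ x : H, c * ‖x‖ ^ 2 ≤ inner ℝ (T x) x) : IsUnit T := by
  obtain ⟨ω, hω, hn⟩ := exists_omega T hc h
  have h1 : IsUnit (1 - (1 - ω • T)) := isUnit_one_sub_of_norm_lt_one hn
  rw [sub_sub_cancel] at h1
  have h2 : T = algebraMap ℝ Op ω⁻¹ * (ω • T) := by
    rw [← Algebra.smul_def, smul_smul, inv_mul_cancel₀ hω.ne', one_smul]
  rw [h2]
  exact ((IsUnit.mk0 _ (inv_ne_zero hω.ne')).map (algebraMap ℝ Op)).mul h1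

lemma neumann_apply (ω : ℝ) (s : Finset ℕ) (B : ℕ → Op) (x : H) (p : ℕ) :
    ((1 - ω • ∑ k ∈ s, B k : Op) x) p = x p - ω * ∑ k ∈ s, (B k x) p := by
  have h : ∀ y : H, y p = lp.evalCLM ℝ (fun _ : ℕ => ℝ) 2 p y := fun y => rfl
  simp only [h]
  simp [_root_.sum_apply, map_sum]


/-- unit block lower triangular -/
def UL (blk : ℕ → ℕ) (A : Op) : Prop := ∀ p q, blk p ≤ blk q → toMat A p q = idMat p q

lemma UL.step {blk : ℕ → ℕ} {A : Op} (hA : UL blk A) (x : H) (p : ℕ)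
    (h : ∀ r, blk r < blk p → x r = 0) : (A x) p = x p := by
  have : ((A - 1) x) p = 0 := by
    apply op_zero
    intro q
    by_cases hq : blk p ≤ blk q
    · left
      rw [toMat_sub, matSub, hA p q hq, toMat_one, sub_self]
    · right; exact h q (not_le.1 hq)
  have h2 : ((A - 1) x) p = (A x) p - x p := by simp
  linarith

lemma UL.solve {blk : ℕ → ℕ} {A : Op} (hA : UL blk A) (x : H) (i : ℕ)
    (h : ∀ r, blk r < i → (A x) r = 0) : ∀ r, blk r < i → x r = 0 := by
  have : ∀ j, ∀ r, blk r = j → j < i → x r = 0 := by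
    intro j
    induction j using Nat.strong_induction_on with
    | _ j ih =>
      intro r hr hj
      rw [← hA.step x r (fun s hs => ih (blk s) (hr ▸ hs) s rfl (by omega))]
      exact h r (by omega)
  exact fun r hr => this _ r rfl hr

lemma UL.inj {blk : ℕ → ℕ} {A : Op} (hA : UL blk A) (x : H) (h : A x = 0) : x = 0 := by
  ext p
  exact hA.solve x (blk p + 1) (fun r _ => by rw [h]; rfl) p (Nat.lt_succ_self _)

lemma UL.inv {blk : ℕ → ℕ} {A X : Op} (hA : UL blk A) (h : A * X = 1) : UL blk X := by
  have h1 : ∀ q, A (X (e q)) = e q := fun q => by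
    change (A * X) (e q) = e q
    rw [h]; rfl
  intro p q hpq
  have h2 : ∀ r, blk r < blk q → (X (e q)) r = 0 := by
    apply hA.solve
    intro r hr
    rw [h1, e_apply, if_neg]
    rintro rfl; exact lt_irrefl _ hr
  have h3 := hA.step (X (e q)) p (fun r hr => h2 r (hr.trans_le hpq))
  rw [h1] at h3
  rw [toMat, ← h3, e_apply, idMat]

lemma UL.isUnit {blk : ℕ → ℕ} {A X : Op} (hA : UL blk A) (h : A * X = 1) : X * A = 1 := by
  ext1 x
  have h0 : A ((X * A) x - x) = 0 := by
    have : A ((X * A) x) = (A * X) (A x) := rfl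
    rw [map_sub, this, h]; simp
  have := hA.inj _ h0
  rw [sub_eq_zero] at this
  rw [this]; rfl

/-- block distance -/
def bd (blk : ℕ → ℕ) : ℕ → ℕ → ℝ := fun p q => |(blk p : ℝ) - blk q|

lemma bd_semi (blk : ℕ → ℕ) : Semi (bd blk) :=
  ⟨fun p => by simp [bd], fun p q r => abs_sub_le _ _ _⟩

lemma bd_star {blk : ℕ → ℕ} {b : ℝ} {T : Op} (h : OBand (bd blk) b T) :
    OBand (bd blk) b (star T) := by
  intro p q hh
  rw [toMat_star]
  apply h
  rwa [bd, abs_sub_comm]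

lemma bd_win {blk : ℕ → ℕ} {w : ℕ} {T : Op} (h : OBand (bd blk) w T) (p q : ℕ)
    (hq : toMat T p q ≠ 0) (hle : blk q ≤ blk p) : q ∈ win blk w (blk p) := by
  refine ⟨?_, hle⟩
  by_contra hcon
  apply hq
  apply h
  push Not at hcon
  have h1 : ((blk q : ℝ) + w) < blk p := by exact_mod_cast hcon
  rw [bd]
  exact lt_of_lt_of_le (by linarith) (le_abs_self _)

/-- diagonal part -/
lemma exists_diag (blk : ℕ → ℕ) (T : Op) :
    ∃ D : Op, (∀ x p, (D x) p = (T (ind {r | blk r = blk p} x)) p) ∧ ‖D‖ ≤ ‖T‖ := by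
  obtain ⟨D, h1, h2⟩ := exists_rows blk (fun i => T * ind {r | blk r = i}) ‖T‖ (norm_nonneg _) 0
    (fun i => (norm_mul_le _ _).trans (mul_le_of_le_one_right (norm_nonneg _) (ind_norm _)))
    (by
      intro p q h
      by_contra hcon
      apply h
      change (T (ind _ (e q))) p = 0
      have : ind {r | blk r = blk p} (e q) = 0 := by
        ext r
        by_cases hr : blk r = blk p
        · rw [ind_of_mem _ (show r ∈ {r | blk r = blk p} from hr), e_apply, if_neg]
          · rfl
          rintro rfl
          apply hcon
          simp [win, hr]
        · rw [ind_of_notMem _ (show r ∉ {r | blk r = blk p} from hr)]; rfl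
      rw [this]; simp)
  exact ⟨D, h1, by simpa using h2⟩

noncomputable def diag (blk : ℕ → ℕ) (T : Op) : Op := (exists_diag blk T).choose

lemma diag_apply (blk : ℕ → ℕ) (T : Op) (x : H) (p : ℕ) :
    (diag blk T x) p = (T (ind {r | blk r = blk p} x)) p := (exists_diag blk T).choose_spec.1 x p

lemma diag_norm (blk : ℕ → ℕ) (T : Op) : ‖diag blk T‖ ≤ ‖T‖ := (exists_diag blk T).choose_spec.2

lemma diag_sub (blk : ℕ → ℕ) (S T : Op) : diag blk (S - T) = diag blk S - diag blk T := by
  ext x p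
  have : ((diag blk S - diag blk T) x) p = (diag blk S x) p - (diag blk T x) p := by simp
  rw [this, diag_apply, diag_apply, diag_apply]; simp

lemma diag_tendsto (blk : ℕ → ℕ) (S : ℕ → Op) (T : Op) (h : Tendsto S atTop (𝓝 T)) :
    Tendsto (fun N => diag blk (S N)) atTop (𝓝 (diag blk T)) := by
  rw [tendsto_iff_norm_sub_tendsto_zero] at h ⊢
  refine squeeze_zero (fun _ => norm_nonneg _) (fun N => ?_) h
  rw [← diag_sub]; exact diag_norm _ _

lemma diag_toMat (blk : ℕ → ℕ) (T : Op) (p q : ℕ) :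
    toMat (diag blk T) p q = if blk p = blk q then toMat T p q else 0 := by
  rw [toMat, diag_apply]
  have : ind {r | blk r = blk p} (e q) = if blk p = blk q then e q else 0 := by
    ext r
    by_cases hr : blk r = blk p
    · rw [ind_of_mem _ (show r ∈ {r | blk r = blk p} from hr)]
      split_ifs with h
      · rfl
      · rw [e_apply, if_neg]
        · rfl
        rintro rfl; exact h hr.symm
    · rw [ind_of_notMem _ (show r ∉ {r | blk r = blk p} from hr)]
      split_ifs with h
      · rw [e_apply, if_neg]
        rintro rfl; exact hr h.symm
      · rfl
  rw [this]
  split_ifs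
  · rfl
  · simp

lemma key (blk : ℕ → ℕ) (T : Op) {c : ℝ} (hc : 0 < c)
    (hT : ∀ x : H, c * ‖x‖ ^ 2 ≤ inner ℝ (T x) x) (b₀ : ℕ) (hbb : OBand (bd blk) b₀ T) :
    ∃ (A : ℕ → Op) (A' : Op), Tendsto A atTop (𝓝 A') ∧ (∀ N, UL blk (A N)) ∧ UL blk A' ∧
      (∀ δ, Semi δ → OBand δ b₀ T → ∀ N, OBand δ (((N + 1) * b₀ : ℕ) : ℝ) (A N)) ∧
      ∀ p q, blk q < blk p → toMat (A' * T) p q = 0 := by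
  obtain ⟨ω, hω, hq1⟩ := exists_omega T hc hT
  set q : ℝ := ‖1 - ω • T‖ with hq
  have hq0 : 0 ≤ q := norm_nonneg _
  let P : ℕ → Op := fun i => ind {r | blk r < i}
  have hPP : ∀ i, P i * P i = P i := fun i => ind_mul_self _
  have hPn : ∀ i, ‖P i‖ ≤ 1 := fun i => ind_norm _
  let G : ℕ → Op := fun i => P i * (1 - ω • T) * P i
  have hGn : ∀ i, ‖G i‖ ≤ q := fun i => by
    calc ‖G i‖ ≤ ‖P i‖ * ‖1 - ω • T‖ * ‖P i‖ := norm_mul₃_le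
      _ ≤ 1 * q * 1 := by gcongr <;> apply hPn
      _ = q := by ring
  have hGP : ∀ i, G i * P i = G i := fun i => by simp only [G, mul_assoc, hPP]
  have hPGk : ∀ i k, P i * G i ^ k * P i = P i * G i ^ k := fun i k => by
    cases k with
    | zero => simp [hPP]
    | succ k => rw [pow_succ, mul_assoc, mul_assoc, hGP]
  let R : ℕ → ℕ → Op := fun k i => T * P i * G i ^ k
  have hRn : ∀ k i, ‖R k i‖ ≤ ‖T‖ * q ^ k := fun k i => by
    have h1 : ‖G i ^ k‖ ≤ q ^ k := by
      rcases Nat.eq_zero_or_pos k with rfl | hk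
      · rw [pow_zero, pow_zero]; exact ContinuousLinearMap.norm_id_le (𝕜 := ℝ) (E := H)
      · exact (norm_pow_le' _ hk).trans (pow_le_pow_left₀ (norm_nonneg _) (hGn i) k)
    calc ‖R k i‖ ≤ ‖T‖ * ‖P i‖ * ‖G i ^ k‖ := norm_mul₃_le
      _ ≤ ‖T‖ * 1 * q ^ k := by gcongr; apply hPn
      _ = _ := by ring
  have hRb : ∀ δ, Semi δ → OBand δ b₀ T → ∀ k i, OBand δ (((k + 1) * b₀ : ℕ) : ℝ) (R k i) := by
    intro δ hδ hb k i
    have hb0 : (0 : ℝ) ≤ b₀ := Nat.cast_nonneg _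
    have hG : OBand δ b₀ (G i) := by
      have := ((OBand.ind hδ {r | blk r < i}).mul hδ
        ((OBand.one hδ hb0).sub (hb.smul ω))).mul hδ (OBand.ind hδ {r | blk r < i})
      simpa using this
    have := (hb.mul hδ (OBand.ind hδ {r | blk r < i})).mul hδ (hG.pow hδ k)
    refine this.mono ?_
    push_cast; linarith
  have hRz : ∀ k i p q, i ≤ blk q → toMat (R k i) p q = 0 := by
    intro k i p q h
    have h1 : P i (e q) = 0 := by
      ext r
      by_cases hr : blk r < i
      · rw [ind_of_mem _ (show r ∈ {r | blk r < i} from hr), e_apply, if_neg]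
        · rfl
        rintro rfl; omega
      · rw [ind_of_notMem _ (show r ∉ {r | blk r < i} from hr)]; rfl
    have h2 : R k i = R k i * P i := by
      simp only [R]; rw [mul_assoc T, mul_assoc T, hPGk]
    rw [h2]
    change (R k i (P i (e q))) p = 0
    rw [h1]; simp
  have hrows : ∀ k, ∃ S : Op, (∀ x p, (S x) p = (R k (blk p) x) p) ∧
      ‖S‖ ≤ ‖T‖ * q ^ k * (((k + 1) * b₀ : ℕ) + 1) := by
    intro k
    refine exists_rows blk (R k) _ (by positivity) ((k + 1) * b₀) (hRn k) ?_
    intro p r hr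
    refine bd_win (hRb _ (bd_semi blk) hbb k (blk p)) p r hr ?_
    by_contra hcon
    exact hr (hRz k (blk p) p r (by omega))
  choose S hS hSn using hrows
  have hsum : Summable S := by
    refine Summable.of_norm_bounded (g := fun k : ℕ => ‖T‖ * q ^ k * (((k + 1) * b₀ : ℕ) + 1)) ?_ hSn
    have hqn : ‖q‖ < 1 := by rwa [Real.norm_eq_abs, abs_of_nonneg hq0]
    have h1 := summable_pow_mul_geometric_of_norm_lt_one 1 hqn
    have h2 := summable_geometric_of_lt_one hq0 hq1
    have h3 := (h1.mul_left (‖T‖ * b₀)).add (h2.mul_left (‖T‖ * (b₀ + 1)))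
    refine h3.congr ?_
    intro k; push_cast; ring
  let A : ℕ → Op := fun N => 1 - ω • ∑ k ∈ Finset.range N, S k
  let A' : Op := 1 - ω • ∑' k, S k
  have hlim : Tendsto A atTop (𝓝 A') :=
    tendsto_const_nhds.sub (hsum.hasSum.tendsto_sum_nat.const_smul ω)
  have hev : ∀ (B : ℕ → Op) (B' : Op) (x : H) (p : ℕ), Tendsto B atTop (𝓝 B') →
      Tendsto (fun N => (B N x) p) atTop (𝓝 ((B' x) p)) := by
    intro B B' x p h
    have h1 : Continuous fun B : Op => lp.evalCLM ℝ (fun _ : ℕ => ℝ) 2 p (B x) := by fun_prop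
    exact (h1.tendsto B').comp h
  have hAx : ∀ N x p, (A N x) p = x p - ω * ∑ k ∈ Finset.range N, (R k (blk p) x) p := by
    intro N x p
    simp only [A]
    rw [← Finset.sum_congr rfl (fun k _ => hS k x p)]
    exact neumann_apply _ _ _ _ _
  have hUL : ∀ N, UL blk (A N) := by
    intro N p r hpr
    have h0 : ∑ k ∈ Finset.range N, (R k (blk p) (e r)) p = 0 :=
      Finset.sum_eq_zero (fun k _ => hRz k (blk p) p r hpr)
    rw [toMat, hAx, h0, e_apply, idMat]
    simp
  refine ⟨A, A', hlim, hUL, ?_, ?_, ?_⟩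
  · intro p r hpr
    have h1 := hev A A' (e r) p hlim
    refine tendsto_nhds_unique h1 ?_
    have : (fun N => (A N (e r)) p) = fun _ => idMat p r := by
      funext N; exact hUL N p r hpr
    rw [this]; exact tendsto_const_nhds
  · intro δ hδ hb N
    refine (OBand.one hδ (Nat.cast_nonneg _)).sub (OBand.smul ω (OBand.sum _ ?_))
    intro k hk p r hpr
    rw [toMat, hS]
    refine hRb δ hδ hb k (blk p) p r (lt_of_le_of_lt ?_ hpr)
    have : k < N := Finset.mem_range.1 hk
    exact_mod_cast Nat.mul_le_mul_right _ (by omega)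
  · intro p r hr
    have htel : ∀ i N, (1 - ω • ∑ k ∈ Finset.range N, R k i) * T * P i = T * P i * G i ^ N := by
      intro i N
      induction N with
      | zero => simp
      | succ N ih =>
        rw [Finset.sum_range_succ, smul_add, ← sub_sub, sub_mul, sub_mul, ih, pow_succ]
        have h1 : G i = P i - ω • (P i * T * P i) := by
          simp only [G, mul_sub, sub_mul, mul_one, hPP]; simp
        have h2 : T * P i * (G i ^ N * G i) = (T * (P i * G i ^ N * P i)) -
            ω • (T * (P i * G i ^ N * P i) * T * P i) := by
          have h3 : G i ^ N * G i = G i ^ N * (P i - ω • (P i * T * P i)) := by rw [← h1]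
          rw [h3, mul_sub, mul_sub]
          simp only [mul_assoc, mul_smul_comm]
        rw [h2, hPGk]
        simp only [R, mul_assoc, smul_mul_assoc]
    have hPe : P (blk p) (e r) = e r := by
      ext s
      by_cases hs : blk s < blk p
      · rw [ind_of_mem _ (show s ∈ {r | blk r < blk p} from hs)]
      · rw [ind_of_notMem _ (show s ∉ {r | blk r < blk p} from hs), e_apply, if_neg]
        rintro rfl; exact hs hr
    have h1 : ∀ N, (A N (T (e r))) p = (R N (blk p) (e r)) p := by
      intro N
      rw [hAx]
      have h2 := congrArg (fun B : Op => (B (e r)) p) (htel (blk p) N)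
      simp only [mul_apply_eq_comp, hPe] at h2
      refine Eq.trans ?_ h2
      exact (neumann_apply _ _ _ _ _).symm
    have h3 := hev A A' (T (e r)) p hlim
    refine tendsto_nhds_unique h3 ?_
    simp_rw [h1]
    have h4 : Tendsto (fun N : ℕ => ‖T‖ * q ^ N * ‖e r‖) atTop (𝓝 0) := by
      have := ((tendsto_pow_atTop_nhds_zero_of_lt_one hq0 hq1).const_mul ‖T‖).mul_const ‖e r‖
      simpa using this
    refine squeeze_zero_norm (fun N => ?_) h4
    exact (lp.norm_apply_le_norm (by simp) _ p).trans ((R N (blk p)).le_of_opNorm_le (hRn _ _) _)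

lemma block_coercive (blk : ℕ → ℕ) (A T : Op) {c : ℝ} (hc : 0 ≤ c)
    (hT : ∀ x : H, c * ‖x‖ ^ 2 ≤ inner ℝ (T x) x) (hA : UL blk A)
    (hup : ∀ p q, blk q < blk p → toMat (A * T) p q = 0) (i : ℕ) (y : H)
    (hy : ∀ q, blk q ≠ i → y q = 0) : c * ‖y‖ ^ 2 ≤ inner ℝ ((A * T) y) y := by
  set z := star A y with hz
  have h1 : ∀ r, i ≤ blk r → z r = y r := by
    intro r hr
    have : ((star A - 1) y) r = 0 := by
      apply op_zero
      intro q
      by_cases hq : blk q = i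
      · left
        rw [toMat_sub, matSub, toMat_star, hA q r (by omega), toMat_one]
        simp [idMat, eq_comm]
      · right; exact hy q hq
    have h2 : ((star A - 1) y) r = z r - y r := by simp [hz]
    linarith
  have h2 : ∀ p, blk p = i → ((A * T) y) p = ((A * T) z) p := by
    intro p hp
    apply op_congr
    intro q
    by_cases hq : blk q < blk p
    · exact Or.inl (hup p q hq)
    · right; rw [h1 q (by omega)]
  have h3 : inner ℝ ((A * T) y) y = inner ℝ ((A * T) z) y := by
    rw [← (hasSum_in _ _).tsum_eq, ← (hasSum_in _ _).tsum_eq]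
    congr 1; funext p
    by_cases hp : blk p = i
    · rw [h2 p hp]
    · rw [hy p hp]; simp
  have h4 : inner ℝ ((A * T) z) y = inner ℝ (T z) z := by
    conv_rhs => rw [hz]
    rw [ContinuousLinearMap.star_eq_adjoint, ContinuousLinearMap.adjoint_inner_right]
    rfl
  rw [h3, h4]
  refine le_trans ?_ (hT z)
  have h5 : ‖y‖ ≤ ‖z‖ := by
    apply lp.norm_mono (by simp)
    intro p
    by_cases hp : blk p = i
    · rw [h1 p (by omega)]
    · rw [hy p hp]; simp
  gcongr

lemma diag_coercive (blk : ℕ → ℕ) (A T : Op) {c : ℝ} (hc : 0 ≤ c)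
    (hT : ∀ x : H, c * ‖x‖ ^ 2 ≤ inner ℝ (T x) x) (hA : UL blk A)
    (hup : ∀ p q, blk q < blk p → toMat (A * T) p q = 0) (x : H) :
    c * ‖x‖ ^ 2 ≤ inner ℝ (diag blk (A * T) x) x := by
  have h1 := (hasSum_in (diag blk (A * T) x) x).sub ((hasSum_sq x).mul_left c)
  have h2 := h1.tsum_fiberwise blk
  have h3 : 0 ≤ inner ℝ (diag blk (A * T) x) x - c * ‖x‖ ^ 2 := by
    refine h2.nonneg ?_
    intro i
    set y := ind {r | blk r = i} x with hy
    have hyin : ∀ p, blk p = i → y p = x p := fun p hp =>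
      ind_of_mem _ (show p ∈ {r | blk r = i} from hp)
    have hyout : ∀ p, blk p ≠ i → y p = 0 := fun p hp =>
      ind_of_notMem _ (show p ∉ {r | blk r = i} from hp)
    have h4 := (hasSum_in ((A * T) y) y).sub ((hasSum_sq y).mul_left c)
    have h5 := block_coercive blk A T hc hT hA hup i y hyout
    refine le_of_le_of_eq (sub_nonneg.2 h5) ?_
    rw [← h4.tsum_eq, tsum_subtype (blk ⁻¹' {i})
      (fun p => (diag blk (A * T) x) p * x p - c * (x p) ^ 2)]
    congr 1; funext p
    by_cases hp : blk p = i
    · rw [Set.indicator_of_mem (show p ∈ blk ⁻¹' {i} from hp), diag_apply, hp, ← hy, hyin p hp]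
    · rw [Set.indicator_of_notMem (show p ∉ blk ⁻¹' {i} from hp), hyout p hp]; simp
  linarith

lemma exists_blk (n : ℕ → ℕ) (hn : IsBlockStructure n) :
    ∃ blk : ℕ → ℕ, ∀ i p, InBlock n i p ↔ blk p = i := by
  obtain ⟨hm, h0⟩ := hn
  have hex : ∀ p, ∃ i, InBlock n i p := by
    intro p
    induction p with
    | zero => exact ⟨0, by rw [h0], by have : n 0 < n (0 + 1) := hm (Nat.lt_succ_self 0); omega⟩
    | succ p ih =>
      obtain ⟨i, h1, h2⟩ := ih
      by_cases h : p + 1 < n (i + 1)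
      · exact ⟨i, by omega, h⟩
      · exact ⟨i + 1, by omega, by have := hm (Nat.lt_succ_self (i + 1)); simp at this; omega⟩
  choose blk hblk using hex
  refine ⟨blk, fun i p => ⟨fun h => ?_, fun h => h ▸ hblk p⟩⟩
  obtain ⟨h1, h2⟩ := h
  obtain ⟨h3, h4⟩ := hblk p
  have h5 : n i < n (blk p + 1) := by omega
  have h6 : n (blk p) < n (i + 1) := by omega
  rw [hm.lt_iff_lt] at h5 h6
  omega

lemma main_op (blk : ℕ → ℕ) (T : Op) {c : ℝ} (hc : 0 < c)
    (hT : ∀ x : H, c * ‖x‖ ^ 2 ≤ inner ℝ (T x) x) (b₀ : ℕ) (hbb : OBand (bd blk) b₀ T)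
    (d : ℕ → ℕ → ℝ) (hd : Semi d) (hsymm : ∀ p q, d p q = d q p) (hdb : OBand d b₀ T) :
    ∃ K : ℝ, 0 < K ∧ ∀ ε : ℝ, 0 < ε → ∃ (L D U Li Di Ui : Op) (b : ℕ),
      ‖T - L * D * U‖ ≤ ε ∧ UL blk L ∧ UL blk (star U) ∧
      (∀ p q, blk p ≠ blk q → toMat D p q = 0) ∧
      (∀ x : H, c / 2 * ‖x‖ ^ 2 ≤ inner ℝ (D x) x) ∧
      ‖L‖ ≤ K ∧ ‖D‖ ≤ K ∧ ‖U‖ ≤ K ∧ ‖Li‖ ≤ K ∧ ‖Di‖ ≤ K ∧ ‖Ui‖ ≤ K ∧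
      L * Li = 1 ∧ Li * L = 1 ∧ D * Di = 1 ∧ Di * D = 1 ∧ U * Ui = 1 ∧ Ui * U = 1 ∧
      OBand d b Li ∧ OBand d b D ∧ OBand d b Ui ∧ OBand (bd blk) b Li ∧ OBand (bd blk) b Ui := by
  obtain ⟨A, A', hAl, hA, hA', hAb, hAup⟩ := key blk T hc hT b₀ hbb
  have hTs : ∀ x : H, c * ‖x‖ ^ 2 ≤ inner ℝ (star T x) x := by
    intro x
    rw [ContinuousLinearMap.star_eq_adjoint, ContinuousLinearMap.adjoint_inner_left,
      real_inner_comm]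
    exact hT x
  obtain ⟨B, B', hBl, hB, hB', hBb, hBup⟩ := key blk (star T) hc hTs b₀ (bd_star hbb)
  have hband_star : ∀ δ : ℕ → ℕ → ℝ, (∀ p q, δ p q = δ q p) → ∀ (b : ℝ) (S : Op), OBand δ b S →
      OBand δ b (star S) := by
    intro δ hδ b S hS p q h
    rw [toMat_star]
    exact hS q p (by rwa [hδ])
  have hbsymm : ∀ p q, bd blk p q = bd blk q p := fun p q => abs_sub_comm _ _
  set D' := diag blk (A' * T) with hD'
  have hDl : Tendsto (fun N => diag blk (A N * T)) atTop (𝓝 D') :=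
    diag_tendsto blk _ _ (hAl.mul_const T)
  have hVl : Tendsto (fun N => star (B N)) atTop (𝓝 (star B')) :=
    (continuous_star.tendsto B').comp hBl
  have hDc : ∀ x : H, c * ‖x‖ ^ 2 ≤ inner ℝ (D' x) x :=
    diag_coercive blk A' T hc.le hT hA' hAup
  have hDu : IsUnit D' := isUnit_of_coercive D' hc hDc
  have hBsz : ∀ p q, blk q ≤ blk p → toMat (star B') p q = idMat p q := by
    intro p q h
    rw [toMat_star, hB' q p h]; simp [idMat, eq_comm]
  have hTV : ∀ p q, blk p < blk q → toMat (T * star B') p q = 0 := by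
    intro p q h
    have : T * star B' = star (B' * star T) := by rw [star_mul, star_star]
    rw [this, toMat_star]; exact hBup q p h
  have hD : D' = A' * T * star B' := by
    apply op_ext
    intro p q
    rw [hD', diag_toMat]
    split_ifs with h
    · change ((A' * T) (e q)) p = ((A' * T) (star B' (e q))) p
      apply op_congr
      intro r
      by_cases hr : blk r < blk p
      · exact Or.inl (hAup p r hr)
      · right
        rw [e_apply]; exact (hBsz r q (by omega)).symm
    · rcases lt_or_gt_of_ne h with h | h
      · rw [mul_assoc]
        symm
        change (A' ((T * star B') (e q))) p = 0
        apply op_zero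
        intro r
        by_cases hr : blk p < blk r
        · left
          rw [hA' p r hr.le, idMat, if_neg]
          rintro rfl; exact lt_irrefl _ hr
        · right; exact hTV r q (by omega)
      · symm
        change ((A' * T) (star B' (e q))) p = 0
        apply op_zero
        intro r
        by_cases hr : blk r < blk p
        · exact Or.inl (hAup p r hr)
        · right
          refine (hBsz r q (by omega)).trans ?_
          rw [idMat, if_neg]
          rintro rfl; omega
  have hDi1 : D' * Ring.inverse D' = 1 := Ring.mul_inverse_cancel _ hDu
  have hDi2 : Ring.inverse D' * D' = 1 := Ring.inverse_mul_cancel _ hDu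
  have hA'u : IsUnit A' := by
    have h1 : A' * (T * star B' * Ring.inverse D') = 1 := by
      rw [← hDi1]; nth_rewrite 2 [hD]; simp only [mul_assoc]
    exact ⟨⟨A', _, h1, hA'.isUnit h1⟩, rfl⟩
  have hB'u : IsUnit B' := by
    have h0 : (Ring.inverse D' * (A' * T)) * star B' = 1 := by
      rw [← hDi2]; nth_rewrite 3 [hD]; simp only [mul_assoc]
    have h1 : B' * star (Ring.inverse D' * (A' * T)) = 1 := by
      have := congrArg star h0
      rwa [star_mul, star_star, star_one] at this
    exact ⟨⟨B', _, h1, hB'.isUnit h1⟩, rfl⟩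
  have hV'u : IsUnit (star B') := hB'u.star
  have hinv : ∀ (S : ℕ → Op) (S' : Op), IsUnit S' → Tendsto S atTop (𝓝 S') →
      Tendsto (fun N => Ring.inverse (S N)) atTop (𝓝 (Ring.inverse S')) := by
    rintro S S' ⟨u, rfl⟩ h
    exact (NormedRing.inverse_continuousAt u).tendsto.comp h
  have hunit : ∀ (S : ℕ → Op) (S' : Op), IsUnit S' → Tendsto S atTop (𝓝 S') →
      ∀ᶠ N in atTop, IsUnit (S N) := by
    intro S S' hu h
    exact h.eventually (Units.isOpen.mem_nhds hu)
  have hnorm : ∀ (S : ℕ → Op) (S' : Op), Tendsto S atTop (𝓝 S') →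
      ∀ᶠ N in atTop, ‖S N‖ ≤ ‖S'‖ + 1 := by
    intro S S' h
    filter_upwards [h.norm.eventually (gt_mem_nhds (lt_add_one ‖S'‖))] with N hN using hN.le
  have hLl := hinv _ _ hA'u hAl
  have hUl := hinv _ _ hV'u hVl
  have hDil := hinv _ _ hDu hDl
  have hprod : Tendsto (fun N => Ring.inverse (A N) * diag blk (A N * T) *
      Ring.inverse (star (B N))) atTop (𝓝 T) := by
    have h := (hLl.mul hDl).mul hUl
    have h2 : Ring.inverse A' * D' * Ring.inverse (star B') = T := by
      rw [hD]
      calc _ = (Ring.inverse A' * A') * T * (star B' * Ring.inverse (star B')) := by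
            simp only [mul_assoc]
        _ = T := by
            rw [Ring.inverse_mul_cancel _ hA'u, Ring.mul_inverse_cancel _ hV'u, one_mul, mul_one]
    rwa [h2] at h
  set K := ‖A'‖ + ‖D'‖ + ‖star B'‖ + ‖Ring.inverse A'‖ + ‖Ring.inverse D'‖ +
    ‖Ring.inverse (star B')‖ + 1 with hK
  have n1 := norm_nonneg A'
  have n2 := norm_nonneg D'
  have n3 := norm_nonneg (star B')
  have n4 := norm_nonneg (Ring.inverse A')
  have n5 := norm_nonneg (Ring.inverse D')
  have n6 := norm_nonneg (Ring.inverse (star B'))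
  refine ⟨K, by positivity, ?_⟩
  intro ε hε
  have hε1 : ∀ᶠ N in atTop, ‖Ring.inverse (A N) * diag blk (A N * T) *
      Ring.inverse (star (B N)) - T‖ < ε := by
    have := (tendsto_iff_norm_sub_tendsto_zero.1 hprod).eventually (gt_mem_nhds hε)
    exact this
  have hc1 : ∀ᶠ N in atTop, ‖diag blk (A N * T) - D'‖ < c / 2 :=
    (tendsto_iff_norm_sub_tendsto_zero.1 hDl).eventually (gt_mem_nhds (half_pos hc))
  obtain ⟨N, e1, e2, u1, u2, u3, m1, m2, m3, m4, m5, m6⟩ :=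
    (hε1.and (hc1.and ((hunit _ _ hA'u hAl).and ((hunit _ _ hDu hDl).and ((hunit _ _ hV'u hVl).and
    ((hnorm _ _ hAl).and ((hnorm _ _ hDl).and ((hnorm _ _ hVl).and ((hnorm _ _ hLl).and
    ((hnorm _ _ hDil).and (hnorm _ _ hUl))))))))))).exists
  have hle : (((N + 1) * b₀ : ℕ) : ℝ) ≤ (((N + 2) * b₀ : ℕ) : ℝ) := by
    exact_mod_cast Nat.mul_le_mul_right _ (by omega)
  refine ⟨Ring.inverse (A N), diag blk (A N * T), Ring.inverse (star (B N)), A N,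
    Ring.inverse (diag blk (A N * T)), star (B N), (N + 2) * b₀, ?_, ?_, ?_, ?_, ?_,
    by linarith, by linarith, by linarith, by linarith, by linarith, by linarith,
    Ring.inverse_mul_cancel _ u1, Ring.mul_inverse_cancel _ u1,
    Ring.mul_inverse_cancel _ u2, Ring.inverse_mul_cancel _ u2,
    Ring.inverse_mul_cancel _ u3, Ring.mul_inverse_cancel _ u3, ?_, ?_, ?_, ?_, ?_⟩
  · rw [norm_sub_rev]; exact e1.le
  · exact (hA N).inv (Ring.mul_inverse_cancel _ u1)
  · refine (hB N).inv ?_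
    have := congrArg star (Ring.inverse_mul_cancel _ u3)
    rwa [star_mul, star_star, star_one] at this
  · intro p q h
    rw [diag_toMat, if_neg h]
  · intro x
    have h1 : inner ℝ (diag blk (A N * T) x) x =
        inner ℝ (D' x) x + inner ℝ ((diag blk (A N * T) - D') x) x := by
      rw [← inner_add_left]; congr 1; simp
    have h2 := abs_real_inner_le_norm ((diag blk (A N * T) - D') x) x
    have h3 := (diag blk (A N * T) - D').le_of_opNorm_le e2.le x
    have h4 := mul_le_mul_of_nonneg_right h3 (norm_nonneg x)
    have h5 := (abs_le.1 (h2.trans h4)).1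
    have h6 := hDc x
    rw [h1]; nlinarith
  · exact (hAb d hd hdb N).mono hle
  · intro p q h
    rw [diag_toMat]
    split_ifs
    · refine ((hAb d hd hdb N).mul hd hdb).mono ?_ p q h
      push_cast; linarith
    · rfl
  · exact (hband_star d hsymm _ _ (hBb d hd (hband_star d hsymm _ _ hdb) N)).mono hle
  · exact (hAb _ (bd_semi blk) hbb N).mono hle
  · exact (hband_star _ hbsymm _ _ (hBb _ (bd_semi blk) (hband_star _ hbsymm _ _ hbb) N)).mono hle

end LDU

/-- approximate block-LDU-decomposition `‖M − LDU‖₂ ≤ ε` with unit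
triangular factors `L`, `U`, block-diagonal elliptic `D`, all bounded with bounded
inverses uniformly in `ε`, and `L⁻¹, D, U⁻¹ ∈ B(d,b)` with `L⁻¹, U⁻¹` block-banded. -/
theorem approximate_block_LDU
    (M : Mat) (hbdd : IsBoundedOp M)
    (Cell : ℝ) (hCell : 0 < Cell) (hell : Elliptic M Cell)
    (nseq : ℕ → ℕ) (hn : IsBlockStructure nseq)
    (b₀ : ℕ) (hbb : BlockBanded nseq b₀ M)
    (d : ℕ → ℕ → ℝ) (hd : IsMetric d) (hband : Banded d (b₀ : ℝ) M) :
    ∃ K : ℝ, 0 < K ∧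
      ∀ ε : ℝ, 0 < ε →
        ∃ (L D U : Mat) (b : ℕ),
          BoundedWith (matSub M (matMul (matMul L D) U)) ε ∧
          BlockLower nseq L ∧ UnitDiagBlocks nseq L ∧
          BlockUpper nseq U ∧ UnitDiagBlocks nseq U ∧
          BlockDiag nseq D ∧ (∃ c : ℝ, 0 < c ∧ Elliptic D c) ∧
          BoundedWith L K ∧ BoundedWith D K ∧ BoundedWith U K ∧
          ∃ Linv Dinv Uinv : Mat,
            IsInverseOn L Linv ∧ IsInverseOn D Dinv ∧ IsInverseOn U Uinv ∧
            BoundedWith Linv K ∧ BoundedWith Dinv K ∧ BoundedWith Uinv K ∧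
            Banded d (b : ℝ) Linv ∧ Banded d (b : ℝ) D ∧ Banded d (b : ℝ) Uinv ∧
            BlockBanded nseq b Linv ∧ BlockBanded nseq b Uinv := by

  obtain ⟨T, rfl⟩ := LDU.exists_op M hbdd
  obtain ⟨blk, hblk⟩ := LDU.exists_blk nseq hn
  obtain ⟨hd0, hd1, hd2, hd3⟩ := hd
  have hT : ∀ x : LDU.H, Cell * ‖x‖ ^ 2 ≤ inner ℝ (T x) x := by
    intro x
    have h := hell x (LDU.mem_coe x)
    rw [LDU.mulVec_toMat] at h
    rwa [(LDU.hasSum_sq x).tsum_eq, (LDU.hasSum_in _ _).tsum_eq] at h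
  have hbb' : LDU.OBand (LDU.bd blk) b₀ T := by
    intro p q h
    refine hbb (blk p) (blk q) p q ((hblk _ _).2 rfl) ((hblk _ _).2 rfl) ?_
    rw [LDU.bd] at h
    exact_mod_cast h
  obtain ⟨K, hK, hmain⟩ := LDU.main_op blk T hCell hT b₀ hbb' d
    ⟨fun p => (hd1 p p).2 rfl, fun p q r => hd3 p q r⟩ hd2 hband
  refine ⟨K, hK, fun ε hε => ?_⟩
  obtain ⟨L, D, U, Li, Di, Ui, b, h1, h2, h3, h4, h5, k1, k2, k3, k4, k5, k6, i1, i2, i3, i4, i5, i6,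
    b1, b2, b3, b4, b5⟩ := hmain ε hε
  have hU : ∀ p q, blk q ≤ blk p → LDU.toMat U p q = idMat p q := by
    intro p q h
    have := h3 q p h
    rw [LDU.toMat_star] at this
    rw [this]; simp [idMat, eq_comm]
  have hBB : ∀ S : LDU.Op, LDU.OBand (LDU.bd blk) b S → BlockBanded nseq b (LDU.toMat S) := by
    intro S hS i j p q hp hq h
    rw [hblk] at hp hq
    subst hp hq
    apply hS
    rw [LDU.bd]
    exact_mod_cast h
  refine ⟨LDU.toMat L, LDU.toMat D, LDU.toMat U, b, ?_, ?_, ?_, ?_, ?_, ?_,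
    ⟨Cell / 2, half_pos hCell, LDU.elliptic_toMat D _ h5⟩,
    LDU.bounded_toMat _ k1, LDU.bounded_toMat _ k2, LDU.bounded_toMat _ k3,
    LDU.toMat Li, LDU.toMat Di, LDU.toMat Ui, LDU.inverseOn _ _ i1 i2, LDU.inverseOn _ _ i3 i4,
    LDU.inverseOn _ _ i5 i6, LDU.bounded_toMat _ k4, LDU.bounded_toMat _ k5,
    LDU.bounded_toMat _ k6, b1, b2, b3, hBB _ b4, hBB _ b5⟩
  · rw [← LDU.toMat_mul, ← LDU.toMat_mul, ← LDU.toMat_sub]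
    exact LDU.bounded_toMat _ h1
  · intro i j p q hp hq h
    rw [hblk] at hp hq
    rw [h2 p q (by omega), idMat, if_neg]
    rintro rfl; omega
  · intro i p q hp hq
    rw [hblk] at hp hq
    exact h2 p q (by omega)
  · intro i j p q hp hq h
    rw [hblk] at hp hq
    rw [hU p q (by omega), idMat, if_neg]
    rintro rfl; omega
  · intro i p q hp hq
    rw [hblk] at hp hq
    exact hU p q (by omega)
  · intro i j p q hp hq h
    rw [hblk] at hp hq
    exact h4 p q (by omega)
end

section
/- Let d be a metric on ℕ satisfying the summability condition, γ > 0, and let M : ℕ × ℕ → ℝ belong to the Jaffard class J(d,γ) and be elliptic with constant C_ell > 0 (M induces a bounded operator on ℓ² since M ∈ J(d,γ)). Then M has an LU-factorization M = LU, with L lower triangular and U upper triangular (M_{pq} = Σ_r L_{pr} U_{rq}, the sums having finitely many nonzero terms), such that L and U are invertible with triangular inverses L⁻¹, U⁻¹ and the four matrices |L|, |U|, |L⁻¹|, |U⁻¹| of entrywise absolute values all induce bounded operators on ℓ². -/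
def SummCond (d : ℕ → ℕ → ℝ) : Prop :=
  ∀ ε : ℝ, 0 < ε → ∃ S : ℝ, ∀ i,
    (Summable fun j => Real.exp (-ε * d i j)) ∧ (∑' j, Real.exp (-ε * d i j)) ≤ S

def Jaffard (d : ℕ → ℕ → ℝ) (γ : ℝ) (M : Mat) : Prop :=
  ∀ γ' : ℝ, 0 < γ' → γ' < γ → ∃ C : ℝ, 0 < C ∧ ∀ i j, |M i j| ≤ C * Real.exp (-γ' * d i j)

def LowerTri (M : Mat) : Prop := ∀ i j, i < j → M i j = 0

def UpperTri (M : Mat) : Prop := ∀ i j, j < i → M i j = 0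

open Finset in
lemma elliptic_fin {M : Mat} {c : ℝ} (h : Elliptic M c) (N : ℕ) (x : ℕ → ℝ) :
    c * ∑ i ∈ range N, x i ^ 2 ≤ ∑ i ∈ range N, ∑ j ∈ range N, M i j * x j * x i := by
  set y : ℕ → ℝ := fun i => if i < N then x i else 0 with hy
  have hy0 : ∀ i, i ∉ range N → y i = 0 := by
    intro i hi
    simp only [mem_range] at hi
    simp [hy, hi]
  have hy1 : ∀ i, i ∈ range N → y i = x i := by
    intro i hi
    simp only [mem_range] at hi
    simp [hy, hi]
  have hm : Memℓ2 y := by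
    apply summable_of_ne_finset_zero (s := range N)
    intro i hi
    simp [hy0 i hi]
  have h1 := h y hm
  rw [tsum_eq_sum (s := range N) (fun i hi => by simp [hy0 i hi]),
    tsum_eq_sum (s := range N) (fun i hi => by simp [hy0 i hi])] at h1
  have e1 : ∑ i ∈ range N, y i ^ 2 = ∑ i ∈ range N, x i ^ 2 :=
    sum_congr rfl fun i hi => by rw [hy1 i hi]
  have e2 : ∑ i ∈ range N, mulVec M y i * y i
      = ∑ i ∈ range N, ∑ j ∈ range N, M i j * x j * x i := by
    refine sum_congr rfl fun i hi => ?_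
    rw [hy1 i hi, mulVec, tsum_eq_sum (s := range N) (fun j hj => by simp [hy0 j hj]), sum_mul]
    refine sum_congr rfl fun j hj => ?_
    rw [hy1 j hj]
  rw [e1, e2] at h1
  exact h1

/-- Ellipticity of finite sections. -/
def FinEll (M : Mat) (c : ℝ) : Prop := ∀ (N : ℕ) (x : ℕ → ℝ),
    c * ∑ i ∈ Finset.range N, x i ^ 2
      ≤ ∑ i ∈ Finset.range N, ∑ j ∈ Finset.range N, M i j * x j * x i

open Finset in
lemma FinEll.transpose {M : Mat} {c : ℝ} (h : FinEll M c) : FinEll (fun i j => M j i) c := by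
  intro N x
  refine (h N x).trans (le_of_eq ?_)
  rw [sum_comm]
  refine sum_congr rfl fun i _ => sum_congr rfl fun j _ => ?_
  ring

open Finset in
lemma exists_col {M : Mat} {c : ℝ} (hc : 0 < c) (h : FinEll M c) (n : ℕ) :
    ∃ x : ℕ → ℝ, (∀ i, n < i → x i = 0) ∧
      ∀ i, i ≤ n → ∑ j ∈ range (n + 1), M i j * x j = if i = n then 1 else 0 := by
  let A : Matrix (Fin (n+1)) (Fin (n+1)) ℝ := Matrix.of fun i j => M i j
  have ext_ : ∀ v : Fin (n+1) → ℝ, ∃ x : ℕ → ℝ, (∀ i, n < i → x i = 0) ∧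
      ∀ i : Fin (n+1), x i = v i := by
    intro v
    refine ⟨fun i => if hi : i < n + 1 then v ⟨i, hi⟩ else 0, ?_, ?_⟩
    · intro i hi
      have : ¬ i < n + 1 := by omega
      simp [this]
    · intro i
      exact dif_pos i.2
  have inj : Function.Injective (Matrix.toLin' A) := by
    rw [injective_iff_map_eq_zero]
    intro v hv
    obtain ⟨x, -, hx⟩ := ext_ v
    have h1 := h (n+1) x
    have h2 : ∑ i ∈ range (n+1), ∑ j ∈ range (n+1), M i j * x j * x i = 0 := by
      rw [sum_range]
      refine sum_eq_zero fun i _ => ?_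
      rw [← sum_mul, sum_range]
      have := congrFun hv i
      simp only [Matrix.toLin'_apply, Matrix.mulVec, dotProduct, A, Matrix.of_apply,
        Pi.zero_apply] at this
      simp only [hx, this, zero_mul]
    rw [h2] at h1
    have h3 : ∑ i ∈ range (n+1), x i ^ 2 = 0 := by
      apply le_antisymm _ (sum_nonneg fun i _ => sq_nonneg _)
      by_contra hcon
      push Not at hcon
      have := mul_pos hc hcon
      linarith
    rw [sum_eq_zero_iff_of_nonneg (fun i _ => sq_nonneg _)] at h3
    ext i
    rw [← hx i]
    have := h3 i (mem_range.2 i.2)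
    simpa using this
  obtain ⟨v, hv⟩ := (LinearMap.injective_iff_surjective.1 inj) (fun i => if (i : ℕ) = n then 1 else 0)
  obtain ⟨x, hx0, hx⟩ := ext_ v
  refine ⟨x, hx0, fun i hi => ?_⟩
  have := congrFun hv ⟨i, by omega⟩
  simp only [Matrix.toLin'_apply, Matrix.mulVec, dotProduct, A, Matrix.of_apply] at this
  rw [sum_range]
  simp only [hx]
  exact this

open Finset in
lemma col_decay {d : ℕ → ℕ → ℝ} (hd : IsMetric d) {M : Mat} {c ε : ℝ} (hc : 0 < c) (hε : 0 < ε)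
    (h : FinEll M c)
    (hr : ∀ N i, ∑ j ∈ range N, |M i j| * (Real.exp (ε * d i j) - 1) ≤ c / 2)
    (hl : ∀ N j, ∑ i ∈ range N, |M i j| * (Real.exp (ε * d i j) - 1) ≤ c / 2)
    (n : ℕ) (x : ℕ → ℝ) (hx0 : ∀ i, n < i → x i = 0)
    (hx : ∀ i, i ≤ n → ∑ j ∈ range (n + 1), M i j * x j = if i = n then 1 else 0) (i : ℕ) :
    |x i| ≤ 2 / c * Real.exp (-ε * d i n) := by
  obtain ⟨d0, dz, ds, dt⟩ := hd
  set w : ℕ → ℝ := fun i => Real.exp (ε * d i n) with hw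
  have hwpos : ∀ i, 0 < w i := fun i => Real.exp_pos _
  set y : ℕ → ℝ := fun i => w i * x i with hy
  have hwn : w n = 1 := by simp [hw, (dz n n).2 rfl]
  set Y := ∑ i ∈ range (n+1), y i ^ 2 with hY
  have key : ∑ i ∈ range (n+1), ∑ j ∈ range (n+1), M i j * (w i / w j) * y j * y i = y n := by
    have : ∀ i ∈ range (n+1), ∑ j ∈ range (n+1), M i j * (w i / w j) * y j * y i
        = if i = n then y n else 0 := by
      intro i hi
      have e : ∀ j ∈ range (n+1), M i j * (w i / w j) * y j * y i = (w i * y i) * (M i j * x j) := by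
        intro j _
        simp only [hy]
        have := (hwpos j).ne'
        field_simp
      rw [sum_congr rfl e, ← mul_sum, hx i (by simpa [Nat.lt_succ_iff] using hi)]
      by_cases hin : i = n
      · subst hin; simp [hwn]
      · simp [hin]
    rw [sum_congr rfl this]
    simp
  have a1 : ∀ i j, |1 - w i / w j| ≤ Real.exp (ε * d i j) - 1 := by
    intro i j
    have e : w i / w j = Real.exp (ε * (d i n - d j n)) := by
      simp only [hw]; rw [← Real.exp_sub]; ring_nf
    rw [e]
    have t1 : d i n - d j n ≤ d i j := by linarith [dt i j n]
    have t2 : -(d i n - d j n) ≤ d i j := by linarith [dt j i n, ds i j]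
    have u1 : Real.exp (ε * (d i n - d j n)) ≤ Real.exp (ε * d i j) :=
      Real.exp_le_exp.2 (mul_le_mul_of_nonneg_left t1 hε.le)
    have u2 : Real.exp (-(ε * d i j)) ≤ Real.exp (ε * (d i n - d j n)) := by
      apply Real.exp_le_exp.2
      nlinarith
    have u3 : 2 ≤ Real.exp (ε * d i j) + Real.exp (-(ε * d i j)) := by
      have p := Real.exp_pos (ε * d i j)
      have q := Real.exp_pos (-(ε * d i j))
      have r : Real.exp (ε * d i j) * Real.exp (-(ε * d i j)) = 1 := by
        rw [← Real.exp_add]; simp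
      nlinarith [sq_nonneg (Real.exp (ε * d i j) - Real.exp (-(ε * d i j)))]
    rw [abs_le]; constructor <;> linarith
  have hdiff : ∑ i ∈ range (n+1), ∑ j ∈ range (n+1), M i j * y j * y i
      - ∑ i ∈ range (n+1), ∑ j ∈ range (n+1), M i j * (w i / w j) * y j * y i ≤ c / 2 * Y := by
    set b : ℕ → ℕ → ℝ := fun i j => |M i j| * (Real.exp (ε * d i j) - 1) with hb
    have hle : ∀ i j, M i j * y j * y i - M i j * (w i / w j) * y j * y i
        ≤ b i j * (y i ^ 2 / 2) + b i j * (y j ^ 2 / 2) := by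
      intro i j
      have e : M i j * y j * y i - M i j * (w i / w j) * y j * y i
        = (M i j * (1 - w i / w j)) * (y j * y i) := by ring
      rw [e]
      have b1 : |M i j * (1 - w i / w j)| ≤ b i j := by
        rw [abs_mul]; exact mul_le_mul_of_nonneg_left (a1 i j) (abs_nonneg _)
      have b2 : |y j * y i| ≤ y i ^ 2 / 2 + y j ^ 2 / 2 := by
        rw [abs_le]; constructor <;> nlinarith [sq_nonneg (y i + y j), sq_nonneg (y i - y j)]
      calc _ ≤ |(M i j * (1 - w i / w j)) * (y j * y i)| := le_abs_self _
        _ = |M i j * (1 - w i / w j)| * |y j * y i| := abs_mul _ _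
        _ ≤ b i j * (y i ^ 2 / 2 + y j ^ 2 / 2) :=
            mul_le_mul b1 b2 (abs_nonneg _) ((abs_nonneg _).trans b1)
        _ = _ := by ring
    have s1 : ∑ i ∈ range (n+1), ∑ j ∈ range (n+1), b i j * (y i ^ 2 / 2) ≤ c / 4 * Y := by
      rw [hY, mul_sum]
      refine sum_le_sum fun i _ => ?_
      rw [← sum_mul]
      have := mul_le_mul_of_nonneg_right (hr (n+1) i) (show 0 ≤ y i ^ 2 / 2 by positivity)
      calc _ ≤ _ := this
        _ = _ := by ring
    have s2 : ∑ i ∈ range (n+1), ∑ j ∈ range (n+1), b i j * (y j ^ 2 / 2) ≤ c / 4 * Y := by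
      rw [sum_comm, hY, mul_sum]
      refine sum_le_sum fun i _ => ?_
      rw [← sum_mul]
      have := mul_le_mul_of_nonneg_right (hl (n+1) i) (show 0 ≤ y i ^ 2 / 2 by positivity)
      calc _ ≤ _ := this
        _ = _ := by ring
    rw [← sum_sub_distrib]
    simp_rw [← sum_sub_distrib]
    calc _ ≤ ∑ i ∈ range (n+1), ∑ j ∈ range (n+1),
          (b i j * (y i ^ 2 / 2) + b i j * (y j ^ 2 / 2)) :=
          sum_le_sum fun i _ => sum_le_sum fun j _ => hle i j
      _ = _ := by simp_rw [sum_add_distrib]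
      _ ≤ _ := add_le_add s1 s2
      _ = _ := by ring
  have hE := h (n+1) y
  rw [key] at hdiff
  have hfin : c / 2 * Y ≤ y n := by
    have : c * Y ≤ _ := hE
    linarith
  have hsq : ∀ i, i ≤ n → y i ^ 2 ≤ Y := fun i hi =>
    single_le_sum (f := fun i => y i ^ 2) (fun i _ => sq_nonneg _)
      (mem_range.2 (Nat.lt_succ_of_le hi))
  have hyi : ∀ i, i ≤ n → |y i| ≤ 2 / c := by
    intro i hi
    have hc2 : 0 < c / 2 := by positivity
    have hyn : y n ≤ 2 / c := by
      by_contra hcon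
      push Not at hcon
      have h0 : 0 < y n := lt_trans (by positivity) hcon
      have h1 : 1 < c / 2 * y n := by
        rw [div_lt_iff₀ hc] at hcon; linarith
      have h2 := mul_le_mul_of_nonneg_left (hsq n le_rfl) hc2.le
      nlinarith
    apply abs_le_of_sq_le_sq _ (by positivity)
    refine (hsq i hi).trans ?_
    have : Y ≤ 2 / c * y n := by
      have e : Y = 2 / c * (c / 2 * Y) := by field_simp
      rw [e]
      exact mul_le_mul_of_nonneg_left hfin (by positivity)
    calc Y ≤ _ := this
      _ ≤ 2 / c * (2 / c) := mul_le_mul_of_nonneg_left hyn (by positivity)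
      _ = _ := by ring
  by_cases hi : i ≤ n
  · have := hyi i hi
    simp only [hy, abs_mul, abs_of_pos (hwpos i)] at this
    have e : Real.exp (-ε * d i n) = (w i)⁻¹ := by
      simp only [hw]; rw [← Real.exp_neg]; ring_nf
    rw [e, ← div_eq_mul_inv, le_div_iff₀ (hwpos i)]
    linarith
  · rw [hx0 i (by omega)]
    simp only [abs_zero]
    positivity

/-- exponential decay of entries -/
def Dec (d : ℕ → ℕ → ℝ) (δ K : ℝ) (A : Mat) : Prop :=
  ∀ i j, |A i j| ≤ K * Real.exp (-δ * d i j)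

open Finset in
lemma sum_exp_le {d : ℕ → ℕ → ℝ} {δ S : ℝ}
    (h : ∀ i, (Summable fun j => Real.exp (-δ * d i j)) ∧ (∑' j, Real.exp (-δ * d i j)) ≤ S)
    (F : Finset ℕ) (i : ℕ) : ∑ j ∈ F, Real.exp (-δ * d i j) ≤ S :=
  ((h i).1.sum_le_tsum F (fun _ _ => (Real.exp_pos _).le)).trans (h i).2

open Finset in
lemma schur {d : ℕ → ℕ → ℝ} (hd : IsMetric d) (hsum : SummCond d) {δ K : ℝ} (hδ : 0 < δ)
    {A : Mat} (hA : Dec d δ K A) : IsBoundedOp (fun p q => |A p q|) := by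
  obtain ⟨d0, dz, ds, dt⟩ := hd
  obtain ⟨S, hS⟩ := hsum δ hδ
  have hK : 0 ≤ K := by
    have := (abs_nonneg _).trans (hA 0 0)
    exact nonneg_of_mul_nonneg_left this (Real.exp_pos _)
  have hS0 : 0 ≤ S := by simpa using sum_exp_le hS ∅ 0
  set R := K * S + 1 with hR
  have hRpos : 0 < R := by positivity
  have hAr : ∀ i, Summable fun j => |A i j| := fun i =>
    Summable.of_nonneg_of_le (fun _ => abs_nonneg _) (hA i) ((hS i).1.mul_left K)
  have hAr' : ∀ i, ∑' j, |A i j| ≤ R := by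
    intro i
    have := (hAr i).tsum_le_tsum (hA i) ((hS i).1.mul_left K)
    rw [tsum_mul_left] at this
    have := mul_le_mul_of_nonneg_left (hS i).2 hK
    linarith
  have hAc : ∀ (F : Finset ℕ) j, ∑ i ∈ F, |A i j| ≤ R := by
    intro F j
    have h1 : ∑ i ∈ F, |A i j| ≤ ∑ i ∈ F, K * Real.exp (-δ * d j i) :=
      sum_le_sum fun i _ => by rw [ds j i]; exact hA i j
    rw [← mul_sum] at h1
    have := mul_le_mul_of_nonneg_left (sum_exp_le hS F j) hK
    linarith
  have hA1 : ∀ i j, |A i j| ≤ R := fun i j => by simpa using hAc {i} j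
  refine ⟨R, hRpos.le, fun x hx => ?_⟩
  have hx' : Summable fun i => x i ^ 2 := hx
  have hq : ∀ i, Summable fun j => |A i j| * x j ^ 2 := fun i =>
    Summable.of_nonneg_of_le (fun _ => by positivity)
      (fun j => mul_le_mul_of_nonneg_right (hA1 i j) (sq_nonneg _)) (hx'.mul_left R)
  have habs : ∀ i, Summable fun j => |(|A i j| * x j)| := fun i =>
    Summable.of_nonneg_of_le (fun _ => abs_nonneg _)
      (fun j => by
        rw [abs_mul, abs_abs]
        have h1 : |x j| ≤ 1 + x j ^ 2 := by
          rw [← sq_abs]; nlinarith [sq_nonneg (|x j| - 1), abs_nonneg (x j)]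
        calc _ ≤ |A i j| * (1 + x j ^ 2) := mul_le_mul_of_nonneg_left h1 (abs_nonneg _)
          _ = |A i j| + |A i j| * x j ^ 2 := by ring) ((hAr i).add (hq i))
  have hT : ∀ i, Summable fun j => |A i j| * x j := fun i => (habs i).of_abs
  have hCS : ∀ i, (mulVec (fun p q => |A p q|) x i) ^ 2 ≤ R * ∑' j, |A i j| * x j ^ 2 := by
    intro i
    change (∑' j, |A i j| * x j) ^ 2 ≤ _
    set T := ∑' j, |A i j| * x j with hTd
    set Q := ∑' j, |A i j| * x j ^ 2 with hQ
    have h0 : ∀ t : ℝ, 0 ≤ R * t ^ 2 - 2 * t * T + Q := by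
      intro t
      have h1 : 0 ≤ ∑' j, |A i j| * (t - x j) ^ 2 :=
        tsum_nonneg fun j => by positivity
      have h2 : ∑' j, |A i j| * (t - x j) ^ 2 = t ^ 2 * ∑' j, |A i j| - 2 * t * T + Q := by
        rw [hTd, hQ, ← tsum_mul_left, ← tsum_mul_left,
          ← ((hAr i).mul_left _).tsum_sub ((hT i).mul_left _),
          ← (((hAr i).mul_left _).sub ((hT i).mul_left _)).tsum_add (hq i)]
        congr 1; ext j; ring
      have h3 := mul_le_mul_of_nonneg_left (hAr' i) (sq_nonneg t)
      linarith
    have h4 := h0 (T / R)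
    have e : R * (T / R) ^ 2 - 2 * (T / R) * T + Q = Q - T ^ 2 / R := by field_simp; ring
    rw [e, sub_nonneg, div_le_iff₀ hRpos] at h4
    linarith
  have hF : ∀ F : Finset ℕ, ∑ i ∈ F, (mulVec (fun p q => |A p q|) x i) ^ 2
      ≤ R ^ 2 * ∑' j, x j ^ 2 := by
    intro F
    calc _ ≤ ∑ i ∈ F, R * ∑' j, |A i j| * x j ^ 2 := sum_le_sum fun i _ => hCS i
      _ = R * ∑' j, ∑ i ∈ F, |A i j| * x j ^ 2 := by
          rw [← mul_sum, Summable.tsum_finsetSum fun i _ => hq i]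
      _ ≤ R * ∑' j, R * x j ^ 2 := by
          refine mul_le_mul_of_nonneg_left ?_ hRpos.le
          refine Summable.tsum_le_tsum (fun j => ?_) (summable_sum fun i _ => hq i)
            (hx'.mul_left R)
          rw [← sum_mul]
          exact mul_le_mul_of_nonneg_right (hAc F j) (sq_nonneg _)
      _ = _ := by rw [tsum_mul_left]; ring
  refine ⟨habs, summable_of_sum_le (fun _ => sq_nonneg _) hF, ?_⟩
  unfold l2norm
  rw [← Real.sqrt_sq hRpos.le, ← Real.sqrt_mul (sq_nonneg R)]
  exact Real.sqrt_le_sqrt (Real.tsum_le_of_sum_le (fun _ => sq_nonneg _) hF)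

open Finset in
lemma prod_dec {d : ℕ → ℕ → ℝ} (hd : IsMetric d) {ε S C K : ℝ} (hε : 0 < ε)
    (hS : ∀ i, (Summable fun j => Real.exp (-(ε/2) * d i j)) ∧
      (∑' j, Real.exp (-(ε/2) * d i j)) ≤ S)
    {A B : Mat} (hA : Dec d ε C A) (hB : Dec d ε K B) (F : Finset ℕ) (i j : ℕ) :
    |∑ r ∈ F, A i r * B r j| ≤ C * K * S * Real.exp (-(ε/2) * d i j) := by
  obtain ⟨d0, dz, ds, dt⟩ := hd
  have hC : 0 ≤ C := nonneg_of_mul_nonneg_left ((abs_nonneg _).trans (hA 0 0)) (Real.exp_pos _)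
  have hK : 0 ≤ K := nonneg_of_mul_nonneg_left ((abs_nonneg _).trans (hB 0 0)) (Real.exp_pos _)
  calc _ ≤ ∑ r ∈ F, |A i r * B r j| := abs_sum_le_sum_abs _ _
    _ ≤ ∑ r ∈ F, C * K * Real.exp (-(ε/2) * d i j) * Real.exp (-(ε/2) * d i r) := by
        refine sum_le_sum fun r _ => ?_
        rw [abs_mul]
        calc _ ≤ (C * Real.exp (-ε * d i r)) * (K * Real.exp (-ε * d r j)) :=
              mul_le_mul (hA i r) (hB r j) (abs_nonneg _) (by positivity)
          _ = C * K * Real.exp (-ε * d i r + -ε * d r j) := by rw [Real.exp_add]; ring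
          _ ≤ C * K * Real.exp (-(ε/2) * d i j + -(ε/2) * d i r) := by
              refine mul_le_mul_of_nonneg_left (Real.exp_le_exp.2 ?_) (by positivity)
              nlinarith [dt i r j, d0 r j]
          _ = _ := by rw [Real.exp_add]; ring
    _ = C * K * Real.exp (-(ε/2) * d i j) * ∑ r ∈ F, Real.exp (-(ε/2) * d i r) := by
        rw [mul_sum]
    _ ≤ C * K * Real.exp (-(ε/2) * d i j) * S :=
        mul_le_mul_of_nonneg_left (sum_exp_le hS F i) (by positivity)
    _ = _ := by ring

open Finset in
lemma tri_comm {A B : Mat} (hA : LowerTri A) (hB : LowerTri B)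
    (h : ∀ p q, (∑' r, A p r * B r q) = idMat p q) :
    ∀ p q, (∑' r, B p r * A r q) = idMat p q := by
  intro p q
  set N := max p q + 1 with hN
  have conv : ∀ (A B : Mat), LowerTri A → ∀ p, p < N → ∀ q,
      (∑' r, A p r * B r q) = ∑ r : Fin N, A p r * B r q := by
    intro A B hA p hp q
    rw [tsum_eq_sum (s := range N), sum_range]
    intro r hr
    simp only [mem_range] at hr
    rw [hA p r (by omega), zero_mul]
  have hm : (Matrix.of fun i j : Fin N => A i j) * (Matrix.of fun i j : Fin N => B i j) = 1 := by
    ext i j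
    rw [Matrix.mul_apply, Matrix.one_apply]
    simp only [Matrix.of_apply]
    rw [← conv A B hA i i.2, h]
    simp [idMat, Fin.ext_iff]
  rw [mul_eq_one_comm] at hm
  have hp : p < N := by omega
  have hq : q < N := by omega
  have := congrFun (congrFun hm ⟨p, hp⟩) ⟨q, hq⟩
  rw [Matrix.mul_apply, Matrix.one_apply] at this
  simp only [Matrix.of_apply] at this
  rw [conv B A hB p hp q, this]
  simp [idMat]

open Finset in
lemma exists_eps {d : ℕ → ℕ → ℝ} (hd : IsMetric d) (hsum : SummCond d)
    {γ : ℝ} (hγ : 0 < γ) {C c : ℝ} (hC : 0 < C) (hc : 0 < c) :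
    ∃ ε, 0 < ε ∧ ε ≤ γ / 2 ∧ ∀ M : Mat, Dec d (γ/2) C M →
      ∀ N i, ∑ j ∈ range N, |M i j| * (Real.exp (ε * d i j) - 1) ≤ c / 2 := by
  obtain ⟨d0, dz, ds, dt⟩ := hd
  obtain ⟨S, hS⟩ := hsum (γ/4) (by positivity)
  have hS1 : 1 ≤ S := by
    have := sum_exp_le hS {0} 0
    simpa [(dz 0 0).2 rfl] using this
  have hSp : 0 < S := by linarith
  refine ⟨min (γ/8) (c * γ / (16 * C * S)), by positivity, ?_, ?_⟩
  · exact (min_le_left _ _).trans (by linarith)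
  set ε := min (γ/8) (c * γ / (16 * C * S)) with hε
  have hεp : 0 < ε := by positivity
  have e1 : ε ≤ γ / 8 := min_le_left _ _
  have e2 : ε ≤ c * γ / (16 * C * S) := min_le_right _ _
  intro M hM N i
  have hterm : ∀ j, |M i j| * (Real.exp (ε * d i j) - 1)
      ≤ C * (8 * ε / γ) * Real.exp (-(γ/4) * d i j) := by
    intro j
    set t := d i j with ht
    have ht0 : 0 ≤ t := d0 i j
    have f1 : Real.exp (ε * t) - 1 ≤ ε * t * Real.exp (ε * t) := by
      have := Real.add_one_le_exp (-(ε * t))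
      have p := Real.exp_pos (ε * t)
      have r : Real.exp (ε * t) * Real.exp (-(ε * t)) = 1 := by
        rw [← Real.exp_add]; simp
      nlinarith
    have f2 : t ≤ 8 / γ * Real.exp (γ / 8 * t) := by
      have := Real.add_one_le_exp (γ / 8 * t)
      rw [div_mul_eq_mul_div, le_div_iff₀ hγ]
      linarith
    have f3 : Real.exp (ε * t) ≤ Real.exp (γ / 8 * t) :=
      Real.exp_le_exp.2 (mul_le_mul_of_nonneg_right e1 ht0)
    have f4 : Real.exp (ε * t) - 1 ≤ 8 * ε / γ * Real.exp (γ / 4 * t) := by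
      calc _ ≤ ε * t * Real.exp (ε * t) := f1
        _ ≤ ε * (8 / γ * Real.exp (γ / 8 * t)) * Real.exp (γ / 8 * t) := by gcongr
        _ = 8 * ε / γ * (Real.exp (γ / 8 * t) * Real.exp (γ / 8 * t)) := by ring
        _ = _ := by rw [← Real.exp_add]; ring_nf
    calc _ ≤ (C * Real.exp (-(γ/2) * t)) * (8 * ε / γ * Real.exp (γ / 4 * t)) := by
          refine mul_le_mul (hM i j) f4 ?_ (by positivity)
          rw [sub_nonneg]; exact Real.one_le_exp (by positivity)
      _ = C * (8 * ε / γ) * (Real.exp (-(γ/2) * t) * Real.exp (γ / 4 * t)) := by ring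
      _ = _ := by rw [← Real.exp_add]; ring_nf
  calc _ ≤ ∑ j ∈ range N, C * (8 * ε / γ) * Real.exp (-(γ/4) * d i j) :=
        sum_le_sum fun j _ => hterm j
    _ = C * (8 * ε / γ) * ∑ j ∈ range N, Real.exp (-(γ/4) * d i j) := by rw [mul_sum]
    _ ≤ C * (8 * ε / γ) * S := mul_le_mul_of_nonneg_left (sum_exp_le hS _ i) (by positivity)
    _ = ε * (8 * C * S / γ) := by ring
    _ ≤ c * γ / (16 * C * S) * (8 * C * S / γ) := mul_le_mul_of_nonneg_right e2 (by positivity)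
    _ = c / 2 := by field_simp; norm_num

open Finset in
lemma diag_lower {d : ℕ → ℕ → ℝ} (hd : IsMetric d) (hsum : SummCond d)
    {α : ℝ} (hα : 0 < α) {C c : ℝ} (hC : 0 < C) (hc : 0 < c) {M : Mat} (hM : Dec d α C M)
    (h : FinEll M c) : ∃ β, 0 < β ∧ ∀ (n : ℕ) (x : ℕ → ℝ),
    (∀ i, i ≤ n → ∑ j ∈ range (n + 1), M i j * x j = if i = n then 1 else 0) → β ≤ x n := by
  obtain ⟨d0, dz, ds, dt⟩ := hd
  obtain ⟨S, hS⟩ := hsum α hα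
  have hS1 : 1 ≤ S := by
    have := sum_exp_le hS {0} 0
    simpa [(dz 0 0).2 rfl] using this
  have hSp : 0 < S := by linarith
  refine ⟨c / (C ^ 2 * S), by positivity, fun n x hx => ?_⟩
  have h1 : ∑ i ∈ range (n+1), ∑ j ∈ range (n+1), M i j * x j * x i = x n := by
    have : ∀ i ∈ range (n+1), ∑ j ∈ range (n+1), M i j * x j * x i = if i = n then x n else 0 := by
      intro i hi
      rw [← sum_mul, hx i (by simpa [Nat.lt_succ_iff] using hi)]
      by_cases hin : i = n
      · subst hin; simp
      · simp [hin]
    rw [sum_congr rfl this]; simp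
  have h2 := h (n+1) x
  rw [h1] at h2
  have h3 : ∑ j ∈ range (n+1), M n j ^ 2 ≤ C ^ 2 * S := by
    calc _ ≤ ∑ j ∈ range (n+1), C ^ 2 * Real.exp (-α * d n j) := by
          refine sum_le_sum fun j _ => ?_
          have a := hM n j
          have e1 : Real.exp (-α * d n j) ≤ 1 := by
            rw [Real.exp_le_one_iff]; nlinarith [d0 n j]
          have e0 := Real.exp_pos (-α * d n j)
          rw [← sq_abs]
          calc _ ≤ (C * Real.exp (-α * d n j)) ^ 2 := by gcongr
            _ = C ^ 2 * (Real.exp (-α * d n j) * Real.exp (-α * d n j)) := by ring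
            _ ≤ C ^ 2 * (Real.exp (-α * d n j) * 1) := by gcongr
            _ = _ := by ring
      _ = C ^ 2 * ∑ j ∈ range (n+1), Real.exp (-α * d n j) := by rw [mul_sum]
      _ ≤ _ := mul_le_mul_of_nonneg_left (sum_exp_le hS _ n) (by positivity)
  have h4 := sum_mul_sq_le_sq_mul_sq (range (n+1)) (fun j => M n j) x
  rw [hx n le_rfl] at h4
  simp only [if_true, one_pow] at h4
  have hX : 0 ≤ ∑ j ∈ range (n+1), x j ^ 2 := sum_nonneg fun _ _ => sq_nonneg _
  have h5 : 1 ≤ C ^ 2 * S * ∑ j ∈ range (n+1), x j ^ 2 :=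
    h4.trans (mul_le_mul_of_nonneg_right h3 hX)
  rw [div_le_iff₀ (by positivity)]
  calc c = c * 1 := by ring
    _ ≤ c * (C ^ 2 * S * ∑ j ∈ range (n+1), x j ^ 2) := mul_le_mul_of_nonneg_left h5 hc.le
    _ = (c * ∑ j ∈ range (n+1), x j ^ 2) * (C ^ 2 * S) := by ring
    _ ≤ _ := mul_le_mul_of_nonneg_right h2 (by positivity)

/-- an elliptic Jaffard-class matrix has an LU-factorization whose
factors and their (triangular, two-sided) inverses have entrywise absolute values
inducing bounded operators on ℓ². -/
theorem jaffard_LU_factorization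
    (d : ℕ → ℕ → ℝ) (hd : IsMetric d) (hsum : SummCond d)
    (γ : ℝ) (hγ : 0 < γ) (M : Mat) (hJ : Jaffard d γ M)
    (Cell : ℝ) (hCell : 0 < Cell) (hell : Elliptic M Cell) :
    ∃ L U Linv Uinv : Mat,
      LowerTri L ∧ UpperTri U ∧
      (∀ p q, M p q = ∑' r, L p r * U r q) ∧
      LowerTri Linv ∧ UpperTri Uinv ∧
      (∀ p q, (∑' r, L p r * Linv r q) = idMat p q) ∧
      (∀ p q, (∑' r, Linv p r * L r q) = idMat p q) ∧
      (∀ p q, (∑' r, U p r * Uinv r q) = idMat p q) ∧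
      (∀ p q, (∑' r, Uinv p r * U r q) = idMat p q) ∧
      IsBoundedOp (fun p q => |L p q|) ∧ IsBoundedOp (fun p q => |U p q|) ∧
      IsBoundedOp (fun p q => |Linv p q|) ∧ IsBoundedOp (fun p q => |Uinv p q|) := by
  classical
  obtain ⟨C, hC, hM'⟩ := hJ (γ/2) (by positivity) (by linarith)
  have hM : Dec d (γ/2) C M := hM'
  have hMt : Dec d (γ/2) C (fun i j => M j i) := fun i j => by
    rw [hd.2.2.1 i j]; exact hM j i
  have hE : FinEll M Cell := fun N x => elliptic_fin hell N x
  have hEt := hE.transpose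
  obtain ⟨ε, hε, hεγ, hb⟩ := exists_eps hd hsum hγ hC hCell
  have hMr := hb M hM
  have hMc := hb _ hMt
  obtain ⟨β, hβ, hdiag⟩ := diag_lower hd hsum (half_pos hγ) hC hCell hM hE
  choose X hX0 hX using exists_col hCell hE
  choose Z hZ0 hZ using exists_col hCell hEt
  have hXd : ∀ n i, |X n i| ≤ 2 / Cell * Real.exp (-ε * d i n) := fun n i =>
    col_decay hd hCell hε hE hMr (fun N j => by
      simpa only [hd.2.2.1 j] using hMc N j) n (X n) (hX0 n) (hX n) i
  have hZd : ∀ n i, |Z n i| ≤ 2 / Cell * Real.exp (-ε * d i n) := fun n i =>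
    col_decay hd hCell hε hEt hMc (fun N j => by
      simpa only [hd.2.2.1 j] using hMr N j) n (Z n) (hZ0 n) (hZ n) i
  have hXn : ∀ n, β ≤ X n n := fun n => hdiag n (X n) (hX n)
  have hXpos : ∀ n, 0 < X n n := fun n => hβ.trans_le (hXn n)
  -- the factors
  obtain ⟨Uinv, hUinv⟩ : ∃ V : Mat, V = fun i n => X n i := ⟨_, rfl⟩
  obtain ⟨Linv, hLinv⟩ : ∃ V : Mat, V = fun n j => Z n j / X n n := ⟨_, rfl⟩
  obtain ⟨L, hL⟩ : ∃ V : Mat, V = fun i n => ∑ r ∈ Finset.range (n+1), M i r * Uinv r n := ⟨_, rfl⟩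
  obtain ⟨U, hU⟩ : ∃ V : Mat, V = fun n q => ∑ r ∈ Finset.range (n+1), Linv n r * M r q := ⟨_, rfl⟩
  have tUinv : UpperTri Uinv := fun i j hij => by rw [hUinv]; exact hX0 j i hij
  have tLinv : LowerTri Linv := fun i j hij => by
    rw [hLinv]; simp only [hZ0 i j hij, zero_div]
  have vL : ∀ i n, i ≤ n → L i n = if i = n then 1 else 0 := fun i n hin => by
    rw [hL, hUinv]; exact hX n i hin
  have vU : ∀ n q, q ≤ n → U n q = if q = n then (X n n)⁻¹ else 0 := fun n q hq => by
    have := hZ n q hq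
    rw [hU, hLinv]
    have e : ∑ r ∈ Finset.range (n+1), Z n r / X n n * M r q
        = (X n n)⁻¹ * ∑ r ∈ Finset.range (n+1), M r q * Z n r := by
      rw [Finset.mul_sum]
      refine Finset.sum_congr rfl fun r _ => ?_
      rw [div_eq_mul_inv]; ring
    simp only [e, this]
    simp
  have tL : LowerTri L := fun i j hij => by rw [vL i j hij.le, if_neg hij.ne]
  have tU : UpperTri U := fun i j hij => by rw [vU i j hij.le, if_neg hij.ne]
  -- decay
  have decM : Dec d ε C M := fun i j => (hM i j).trans (by
    refine mul_le_mul_of_nonneg_left (Real.exp_le_exp.2 ?_) hC.le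
    nlinarith [hd.1 i j])
  have decUinv : Dec d ε (2 / Cell) Uinv := fun i j => by rw [hUinv]; exact hXd j i
  have decLinv : Dec d ε (2 / Cell / β) Linv := fun i j => by
    rw [hLinv]
    simp only [abs_div, abs_of_pos (hXpos i)]
    have := hZd i j
    rw [hd.2.2.1 j i] at this
    calc _ ≤ (2 / Cell * Real.exp (-ε * d i j)) / β := by
          have := hXn i
          gcongr
      _ = _ := by ring
  obtain ⟨S, hS⟩ := hsum (ε/2) (by positivity)
  have decL : Dec d (ε/2) _ L := fun i j => by
    rw [hL]; exact prod_dec hd hε hS decM decUinv _ i j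
  have decU : Dec d (ε/2) _ U := fun i j => by
    rw [hU]; exact prod_dec hd hε hS decLinv decM _ i j
  -- inverses
  have s1 : ∀ p q, (∑' r, U p r * Uinv r q) = ∑ r ∈ Finset.range (q+1), U p r * Uinv r q := by
    intro p q
    refine tsum_eq_sum fun r hr => ?_
    simp only [Finset.mem_range] at hr
    rw [tUinv r q (by omega), mul_zero]
  have s2 : ∀ p q, (∑' r, Linv p r * L r q) = ∑ r ∈ Finset.range (p+1), Linv p r * L r q := by
    intro p q
    refine tsum_eq_sum fun r hr => ?_
    simp only [Finset.mem_range] at hr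
    rw [tLinv p r (by omega), zero_mul]
  have s12 : ∀ p q, (∑' r, U p r * Uinv r q) = ∑' r, Linv p r * L r q := by
    intro p q
    rw [s1, s2, hU, hL]
    simp only [Finset.sum_mul, Finset.mul_sum]
    rw [Finset.sum_comm]
    refine Finset.sum_congr rfl fun _ _ => Finset.sum_congr rfl fun _ _ => ?_
    ring
  have hUU : ∀ p q, (∑' r, U p r * Uinv r q) = idMat p q := by
    intro p q
    rcases lt_trichotomy p q with hpq | hpq | hpq
    · rw [s12, s2, idMat, if_neg hpq.ne]
      refine Finset.sum_eq_zero fun r hr => ?_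
      simp only [Finset.mem_range] at hr
      rw [tL r q (by omega), mul_zero]
    · subst hpq
      rw [s1, idMat, if_pos rfl, Finset.sum_range_succ, Finset.sum_eq_zero, zero_add,
        vU p p le_rfl, if_pos rfl, hUinv]
      · exact inv_mul_cancel₀ (hXpos p).ne'
      · intro r hr
        simp only [Finset.mem_range] at hr
        rw [tU p r hr, zero_mul]
    · rw [s1, idMat, if_neg hpq.ne']
      refine Finset.sum_eq_zero fun r hr => ?_
      simp only [Finset.mem_range] at hr
      rw [tU p r (by omega), zero_mul]
  have hLL : ∀ p q, (∑' r, Linv p r * L r q) = idMat p q := fun p q => by rw [← s12, hUU]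
  have hLL' := tri_comm tLinv tL hLL
  have idsymm : ∀ p q, idMat p q = idMat q p := fun p q => by simp only [idMat, eq_comm]
  have hUU' : ∀ p q, (∑' r, Uinv p r * U r q) = idMat p q := by
    intro p q
    have := tri_comm (A := fun i j => Uinv j i) (B := fun i j => U j i)
      (fun i j hij => tUinv j i hij) (fun i j hij => tU j i hij)
      (fun p q => by rw [idsymm, ← hUU q p]; exact tsum_congr fun r => mul_comm _ _) q p
    rw [idsymm, ← this]; exact tsum_congr fun r => mul_comm _ _
  have hMLU : ∀ p q, M p q = ∑' r, L p r * U r q := by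
    intro p q
    have t1 : (∑' r, L p r * U r q) = ∑ r ∈ Finset.range (p+1), L p r * U r q := by
      refine tsum_eq_sum fun r hr => ?_
      simp only [Finset.mem_range] at hr
      rw [tL p r (by omega), zero_mul]
    have t2 : ∀ r ∈ Finset.range (p+1),
        U r q = ∑ s ∈ Finset.range (p+1), Linv r s * M s q := by
      intro r hr
      rw [hU]
      refine Finset.sum_subset (Finset.range_mono (by simp at hr; omega)) fun s _ hs => ?_
      simp only [Finset.mem_range] at hs
      rw [tLinv r s (by omega), zero_mul]
    have t3 : ∀ s, ∑ r ∈ Finset.range (p+1), L p r * Linv r s = idMat p s := by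
      intro s
      rw [← hLL' p s]
      refine (tsum_eq_sum fun r hr => ?_).symm
      simp only [Finset.mem_range] at hr
      rw [tL p r (by omega), zero_mul]
    rw [t1, Finset.sum_congr rfl fun r hr => by rw [t2 r hr]]
    simp only [Finset.mul_sum]
    rw [Finset.sum_comm]
    have t4 : ∀ s ∈ Finset.range (p+1), ∑ r ∈ Finset.range (p+1), L p r * (Linv r s * M s q)
        = if p = s then M p q else 0 := by
      intro s _
      simp only [← mul_assoc]
      rw [← Finset.sum_mul, t3, idMat]
      by_cases h : p = s
      · subst h; simp
      · simp [h]
    rw [Finset.sum_congr rfl t4]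
    simp
  exact ⟨L, U, Linv, Uinv, tL, tU, hMLU, tLinv, tUinv, hLL', hLL, hUU, hUU',
    schur hd hsum (half_pos hε) decL, schur hd hsum (half_pos hε) decU,
    schur hd hsum hε decLinv, schur hd hsum hε decUinv⟩
end
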